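/- arXiv:2505.15964 — 2 statements merged into one kernel-verified Lean document; each statement's English description precedes it below -/
import Mathlib

section
/- Let m ≥ 1 and n ≥ 2. The set of totally irrational matrices ξ ∈ ℝ^{n×m} that satisfy Property (C) but neither Property (A) nor Property (B) is nonempty and has full Hausdorff dimension mn in ℝ^{n×m} ≅ ℝ^{mn}. -/
open Filter

/-- The sup-norm of the `i`-th integer vector `x i`, viewed in `ℝ^m`. -/
noncomputable def Xval {m : ℕ} (x : ℕ → Fin m → ℤ) (i : ℕ) : ℝ :=
  ‖(fun j => (x i j : ℝ))‖

/-- The sup-norm of the remainder `ξ 𝒙ᵢ − 𝒚ᵢ`. -/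
noncomputable def Lval {m n : ℕ} (ξ : Matrix (Fin n) (Fin m) ℝ)
    (x : ℕ → Fin m → ℤ) (y : ℕ → Fin n → ℤ) (i : ℕ) : ℝ :=
  ‖(ξ.mulVec (fun j => (x i j : ℝ)) - (fun k => (y i k : ℝ)))‖

/-- `ξ` is totally irrational: `‖ξ𝒙 − 𝒚‖ > 0` for every nonzero integer pair `(𝒙,𝒚)`. -/
def TotallyIrrational {m n : ℕ} (ξ : Matrix (Fin n) (Fin m) ℝ) : Prop :=
  ∀ (u : Fin m → ℤ) (v : Fin n → ℤ), (u, v) ≠ 0 →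
    0 < ‖(ξ.mulVec (fun j => (u j : ℝ)) - (fun k => (v k : ℝ)))‖

/-- `(𝒙ᵢ, 𝒚ᵢ)_{i}` is a sequence of best approximation vectors for `ξ`
(with respect to the sup norms). -/
structure IsBestApproxSeq {m n : ℕ} (ξ : Matrix (Fin n) (Fin m) ℝ)
    (x : ℕ → Fin m → ℤ) (y : ℕ → Fin n → ℤ) : Prop where
  nonzero : ∀ i, x i ≠ 0
  first : Xval x 0 = 1
  xStrictMono : StrictMono (Xval x)
  lStrictAnti : StrictAnti (Lval ξ x y)
  best : ∀ (i : ℕ) (u : Fin m → ℤ) (v : Fin n → ℤ), u ≠ 0 →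
    ‖(fun j => (u j : ℝ))‖ < Xval x (i + 1) →
    Lval ξ x y i ≤ ‖(ξ.mulVec (fun j => (u j : ℝ)) - (fun k => (v k : ℝ)))‖

/-- Property (A): `ξ` is badly approximable. -/
def PropA {m n : ℕ} (ξ : Matrix (Fin n) (Fin m) ℝ) : Prop :=
  ∃ c : ℝ, 0 < c ∧ ∀ (u : Fin m → ℤ) (v : Fin n → ℤ), u ≠ 0 →
    c ≤ ‖(fun j => (u j : ℝ))‖ ^ m *
        ‖(ξ.mulVec (fun j => (u j : ℝ)) - (fun k => (v k : ℝ)))‖ ^ n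

/-- Property (B): the ratios `X_{i+1}/X_i` are bounded. -/
def PropB {m : ℕ} (x : ℕ → Fin m → ℤ) : Prop :=
  ∃ M : ℝ, ∀ i : ℕ, Xval x (i + 1) / Xval x i ≤ M

/-- Property (C): the ratios `L_i/L_{i+1}` are bounded. -/
def PropC {m n : ℕ} (ξ : Matrix (Fin n) (Fin m) ℝ)
    (x : ℕ → Fin m → ℤ) (y : ℕ → Fin n → ℤ) : Prop :=
  ∃ M : ℝ, ∀ i : ℕ, Lval ξ x y i / Lval ξ x y (i + 1) ≤ M

/-- The ordinary exponent `ω(ξ) = limsup (−log Lᵢ)/(log Xᵢ)`, as a value in `[0,+∞]`. -/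
noncomputable def ordExp {m n : ℕ} (ξ : Matrix (Fin n) (Fin m) ℝ)
    (x : ℕ → Fin m → ℤ) (y : ℕ → Fin n → ℤ) : EReal :=
  limsup (fun i => ((-Real.log (Lval ξ x y i) / Real.log (Xval x i) : ℝ) : EReal)) atTop

/-- The uniform exponent `ω̂(ξ) = liminf (−log Lᵢ)/(log X_{i+1})`, as a value in `[0,+∞]`. -/
noncomputable def unifExp {m n : ℕ} (ξ : Matrix (Fin n) (Fin m) ℝ)
    (x : ℕ → Fin m → ℤ) (y : ℕ → Fin n → ℤ) : EReal :=
  liminf (fun i => ((-Real.log (Lval ξ x y i) / Real.log (Xval x (i + 1)) : ℝ) : EReal)) atTop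

theorem exists_close_of_card_lt {α ι : Type*} [Fintype ι] (S : Finset α) (f : α → ι → ℝ) {s : ℕ}
    (hs : 0 < s) (hf : ∀ a ∈ S, ∀ i, 0 ≤ f a i ∧ f a i < 1)
    (hcard : s ^ Fintype.card ι < S.card) :
    ∃ a ∈ S, ∃ b ∈ S, a ≠ b ∧ ∀ i, |f a i - f b i| < 1 / s := by
  classical
  have hs' : (0 : ℝ) < s := by exact_mod_cast hs
  let F : α → ι → ℕ := fun a i => ⌊f a i * s⌋₊
  have hmaps : ∀ a ∈ S, F a ∈ Fintype.piFinset (fun _ : ι => Finset.range s) := by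
    intro a ha
    rw [Fintype.mem_piFinset]
    intro i
    rw [Finset.mem_range, Nat.floor_lt (by have := (hf a ha i).1; positivity)]
    have := (hf a ha i).2
    nlinarith
  have hc : (Fintype.piFinset (fun _ : ι => Finset.range s)).card < S.card := by
    simpa [Fintype.card_piFinset] using hcard
  obtain ⟨a, ha, b, hb, hab, hF⟩ := Finset.exists_ne_map_eq_of_card_lt_of_maps_to hc hmaps
  refine ⟨a, ha, b, hb, hab, fun i => ?_⟩
  have hi : ⌊f a i * s⌋₊ = ⌊f b i * s⌋₊ := congrFun hF i
  have h1 := Nat.floor_le (a := f a i * s) (by have := (hf a ha i).1; positivity)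
  have h2 := Nat.floor_le (a := f b i * s) (by have := (hf b hb i).1; positivity)
  have h3 := Nat.lt_floor_add_one (f a i * s)
  have h4 := Nat.lt_floor_add_one (f b i * s)
  rw [hi] at h1 h3
  have h5 : |f a i - f b i| * s = |(f a i - f b i) * s| := by rw [abs_mul, abs_of_pos hs']
  rw [lt_div_iff₀ hs', h5, abs_lt]
  constructor <;> nlinarith

/-- Dirichlet's theorem on simultaneous approximation for a system of linear forms. -/
theorem dirichlet_linear_forms {ι κ : Type*} [Fintype ι] [Fintype κ] (θ : ι → κ → ℝ) {A s : ℕ}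
    (hs : 0 < s) (h : s ^ Fintype.card ι < (A + 1) ^ Fintype.card κ) :
    ∃ q : κ → ℤ, q ≠ 0 ∧ (∀ j, |q j| ≤ A) ∧
      ∃ p : ι → ℤ, ∀ i, |∑ j, θ i j * q j - p i| < 1 / s := by
  classical
  let S : Finset (κ → ℕ) := Fintype.piFinset (fun _ => Finset.range (A + 1))
  have hS : S.card = (A + 1) ^ Fintype.card κ := by
    simp [S]
  obtain ⟨a, ha, b, hb, hab, hclose⟩ := exists_close_of_card_lt S
    (fun a i => Int.fract (∑ j, θ i j * a j)) hs
    (fun a _ i => ⟨Int.fract_nonneg _, Int.fract_lt_one _⟩) (by rw [hS]; exact h)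
  refine ⟨fun j => (a j : ℤ) - b j, ?_, ?_,
    fun i => ⌊∑ j, θ i j * a j⌋ - ⌊∑ j, θ i j * b j⌋, ?_⟩
  · intro h0
    apply hab
    funext j
    have := congrFun h0 j
    simp only [Pi.zero_apply] at this
    omega
  · intro j
    have h1 := Finset.mem_range.1 (Fintype.mem_piFinset.1 ha j)
    have h2 := Finset.mem_range.1 (Fintype.mem_piFinset.1 hb j)
    change |(a j : ℤ) - b j| ≤ A
    rw [abs_le]
    constructor <;> omega
  · intro i
    have := hclose i
    have e : ∑ j, θ i j * (((a j : ℤ) - b j : ℤ) : ℝ)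
        = ∑ j, θ i j * a j - ∑ j, θ i j * b j := by
      rw [← Finset.sum_sub_distrib]
      refine Finset.sum_congr rfl fun j _ => ?_
      push_cast
      ring
    rw [e]
    convert this using 2
    simp only [Int.fract]
    push_cast
    ring

/-- Functions that pairwise differ by at most `c` along the coordinate `i₀` are few. -/
theorem card_le_of_fiber_bounded {ι : Type*} [Fintype ι] [DecidableEq ι] {p : ℕ}
    (S : Finset (ι → Fin p)) (i₀ : ι) (c : ℕ)
    (h : ∀ a ∈ S, ∀ b ∈ S, (∀ i, i ≠ i₀ → a i = b i) → (a i₀ : ℕ) ≤ b i₀ + c) :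
    S.card ≤ (c + 1) * p ^ (Fintype.card ι - 1) := by
  classical
  let F : (ι → Fin p) → ({i // i ≠ i₀} → Fin p) := fun a i => a i
  have h1 := Finset.card_le_mul_card_image (f := F) S (c + 1) (by
    intro g hg
    obtain ⟨a₀, ha₀, rfl⟩ := Finset.mem_image.1 hg
    set U := S.filter (fun x => F x = F a₀)
    have hU : U.Nonempty := ⟨a₀, by simp [U, ha₀]⟩
    obtain ⟨b, hb, hmin⟩ := Finset.exists_min_image U (fun a => (a i₀ : ℕ)) hU
    have hagree : ∀ a ∈ U, ∀ i, i ≠ i₀ → a i = b i := by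
      intro a ha i hi
      have e1 := (Finset.mem_filter.1 ha).2
      have e2 := (Finset.mem_filter.1 hb).2
      exact congrFun (e1.trans e2.symm) ⟨i, hi⟩
    have : U.card ≤ (Finset.Icc (b i₀ : ℕ) (b i₀ + c)).card := by
      refine Finset.card_le_card_of_injOn (fun a => (a i₀ : ℕ)) ?_ ?_
      · intro a ha
        simp only [Finset.coe_Icc, Set.mem_Icc]
        exact ⟨hmin a ha, h a (Finset.mem_filter.1 ha).1 b (Finset.mem_filter.1 hb).1
          (hagree a ha)⟩
      · intro a ha a' ha' haa'
        funext i
        by_cases hi : i = i₀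
        · subst hi
          exact Fin.ext haa'
        · rw [hagree a ha i hi, hagree a' ha' i hi]
    rw [Nat.card_Icc] at this
    omega)
  refine h1.trans (Nat.mul_le_mul_left _ ?_)
  refine (Finset.card_le_univ _).trans ?_
  simp [Fintype.card_subtype_compl]

/-- Pairs of integer vectors `(𝒙, 𝒚)`. -/
abbrev IntPair (m n : ℕ) : Type := (Fin m → ℤ) × (Fin n → ℤ)

/-- The remainder `ξ𝒙 - 𝒚` as a linear function of `(𝒙, 𝒚)`. -/
def remainder {m n : ℕ} (ξ : Fin n → Fin m → ℝ) : IntPair m n →ₗ[ℤ] (Fin n → ℝ) :=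
  AddMonoidHom.toIntLinearMap <| AddMonoidHom.mk' (fun v i => ∑ j, ξ i j * v.1 j - v.2 i) <| by
    intro v w
    funext i
    simp only [Prod.fst_add, Prod.snd_add, Pi.add_apply, Int.cast_add, mul_add,
      Finset.sum_add_distrib]
    ring

section Remainder

variable {m n : ℕ}

theorem remainder_apply (ξ : Fin n → Fin m → ℝ) (v : IntPair m n) (i : Fin n) :
    remainder ξ v i = ∑ j, ξ i j * v.1 j - v.2 i := rfl

theorem abs_intCast_le_norm (x : Fin m → ℤ) (j : Fin m) : |(x j : ℝ)| ≤ ‖x‖ := by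
  have := norm_le_pi_norm x j
  rwa [Int.norm_eq_abs] at this

theorem one_le_norm_of_ne_zero {k : ℕ} {x : Fin k → ℤ} (hx : x ≠ 0) : 1 ≤ ‖x‖ := by
  obtain ⟨j, hj⟩ := Function.ne_iff.1 hx
  refine le_trans ?_ (abs_intCast_le_norm x j)
  have : (1 : ℤ) ≤ |x j| := Int.one_le_abs hj
  exact_mod_cast this

theorem exists_abs_eq_norm (x : Fin m → ℤ) (hm : 0 < m) : ∃ j, |(x j : ℝ)| = ‖x‖ := by
  have : Nonempty (Fin m) := ⟨⟨0, hm⟩⟩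
  obtain ⟨j, hj⟩ := Finite.exists_max (fun j => |(x j : ℝ)|)
  refine ⟨j, le_antisymm (abs_intCast_le_norm x j) ?_⟩
  rw [pi_norm_le_iff_of_nonneg (abs_nonneg _)]
  intro i
  rw [Int.norm_eq_abs]
  exact hj i

theorem abs_sum_mul_le {a : Fin m → ℝ} {d : ℝ} (x : Fin m → ℤ) (ha : ∀ j, |a j| ≤ d) :
    |∑ j, a j * x j| ≤ m * d * ‖x‖ := by
  calc |∑ j, a j * x j| ≤ ∑ j, |a j * x j| := Finset.abs_sum_le_sum_abs _ _
    _ ≤ ∑ _j : Fin m, d * ‖x‖ := by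
        refine Finset.sum_le_sum fun j _ => ?_
        rw [abs_mul]
        exact mul_le_mul (ha j) (abs_intCast_le_norm x j) (abs_nonneg _)
          ((abs_nonneg _).trans (ha j))
    _ = m * d * ‖x‖ := by
        simp only [Finset.sum_const, Finset.card_univ, Fintype.card_fin, nsmul_eq_mul]
        ring

theorem abs_entry_le_norm (ξ : Fin n → Fin m → ℝ) (i : Fin n) (j : Fin m) : |ξ i j| ≤ ‖ξ‖ := by
  have h1 := norm_le_pi_norm (ξ i) j
  have h2 := norm_le_pi_norm ξ i
  rw [Real.norm_eq_abs] at h1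
  exact h1.trans h2

theorem matrix_norm_le {ξ : Fin n → Fin m → ℝ} {d : ℝ} (hd : 0 ≤ d) (h : ∀ i j, |ξ i j| ≤ d) :
    ‖ξ‖ ≤ d := by
  rw [pi_norm_le_iff_of_nonneg hd]
  intro i
  rw [pi_norm_le_iff_of_nonneg hd]
  intro j
  rw [Real.norm_eq_abs]
  exact h i j

theorem remainder_sub_remainder_apply (ξ η : Fin n → Fin m → ℝ) (v : IntPair m n) (i : Fin n) :
    remainder ξ v i - remainder η v i = ∑ j, (ξ i j - η i j) * v.1 j := by
  simp only [remainder_apply, sub_mul, Finset.sum_sub_distrib]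
  ring

theorem remainder_add_apply (ξ ζ : Fin n → Fin m → ℝ) (v : IntPair m n) (i : Fin n) :
    remainder (ξ + ζ) v i = remainder ξ v i + ∑ j, ζ i j * v.1 j := by
  simp only [remainder_apply, Pi.add_apply, add_mul, Finset.sum_add_distrib]
  ring

theorem norm_remainder_sub_le (ξ η : Fin n → Fin m → ℝ) (v : IntPair m n) :
    ‖remainder ξ v - remainder η v‖ ≤ m * ‖ξ - η‖ * ‖v.1‖ := by
  rw [pi_norm_le_iff_of_nonneg (by positivity)]
  intro i
  rw [Pi.sub_apply, remainder_sub_remainder_apply, Real.norm_eq_abs]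
  exact abs_sum_mul_le _ fun j => abs_entry_le_norm (ξ - η) i j

theorem norm_remainder_le_of_mem {ξ η : Fin n → Fin m → ℝ} {δ : ℝ}
    (h : η ∈ Metric.closedBall ξ δ) (v : IntPair m n) :
    ‖remainder ξ v‖ ≤ ‖remainder η v‖ + m * δ * ‖v.1‖ := by
  have h1 := norm_remainder_sub_le ξ η v
  have h2 := norm_sub_norm_le (remainder ξ v) (remainder η v)
  have h3 : ‖ξ - η‖ ≤ δ := by
    rw [← dist_eq_norm]
    exact Metric.mem_closedBall'.1 h
  have h4 : (m : ℝ) * ‖ξ - η‖ * ‖v.1‖ ≤ m * δ * ‖v.1‖ := by gcongr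
  linarith

theorem exists_norm_remainder_le_half (ξ : Fin n → Fin m → ℝ) (x : Fin m → ℤ) :
    ∃ y : Fin n → ℤ, ‖remainder ξ (x, y)‖ ≤ 1 / 2 := by
  refine ⟨fun i => round (∑ j, ξ i j * x j), ?_⟩
  rw [pi_norm_le_iff_of_nonneg (by norm_num)]
  intro i
  rw [remainder_apply, Real.norm_eq_abs]
  exact abs_sub_round _

theorem one_le_norm_remainder_of_fst_eq_zero (ξ : Fin n → Fin m → ℝ) {v : IntPair m n}
    (hv : v ≠ 0) (h : v.1 = 0) : 1 ≤ ‖remainder ξ v‖ := by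
  have hy : v.2 ≠ 0 := fun h2 => hv (Prod.ext h h2)
  refine (one_le_norm_of_ne_zero hy).trans ?_
  rw [pi_norm_le_iff_of_nonneg (norm_nonneg _)]
  intro i
  have := norm_le_pi_norm (remainder ξ v) i
  rw [remainder_apply, h] at this
  simpa [Int.norm_eq_abs, ← Int.cast_abs] using this

theorem exists_norm_eq_one (hm : 0 < m) : ∃ x : Fin m → ℤ, x ≠ 0 ∧ ‖x‖ = 1 := by
  refine ⟨fun _ => 1, fun h => ?_, ?_⟩
  · have := congrFun h ⟨0, hm⟩
    simp at this
  · have : Nonempty (Fin m) := ⟨⟨0, hm⟩⟩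
    rw [pi_norm_const]
    simp

/-- The vectors that may obstruct the choice of a ball of radius `ε` inside the ball of centre `ξ`
and radius `δ`. -/
def dangerous (ξ : Fin n → Fin m → ℝ) (δ ε : ℝ) : Set (IntPair m n) :=
  {v | 1 < ‖v.1‖ ∧ ∃ η ∈ Metric.closedBall ξ δ, ‖remainder η v‖ ≤ ε * ‖v.1‖ ∧
    ∀ v' : IntPair m n, v'.1 ≠ 0 → ‖v'.1‖ < ‖v.1‖ → δ * ‖v.1‖ ≤ ‖remainder η v'‖}

/-- An upper bound for the number of dangerous vectors. -/
def packingBound (m n : ℕ) : ℕ := (4 * ((2 * m + 1) * (m + 1) + 1) * (m + 1)) ^ (m + n)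

theorem card_le_of_subset_dangerous (hm : 0 < m) {ξ : Fin n → Fin m → ℝ} {δ ε : ℝ} (hδ : 0 < δ)
    (hε : ε ≤ δ) (T : Finset (IntPair m n)) (hT : ∀ v ∈ T, v ∈ dangerous ξ δ ε) :
    T.card ≤ packingBound m n := by
  by_contra! hcard
  have hne : T.Nonempty := Finset.card_pos.1 (by omega)
  obtain ⟨v₀, hv₀, hmin⟩ := Finset.exists_min_image T (fun v => ‖v.1‖) hne
  obtain ⟨hQ1, η₀, hη₀, hr₀, hs₀⟩ := hT v₀ hv₀
  set Q := ‖v₀.1‖ with hQ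
  have hm0 : (0 : ℝ) < m := by exact_mod_cast hm
  have hQ0 : 0 < Q := by linarith
  have hδQ0 : 0 < δ * Q := mul_pos hδ hQ0
  have hδQ : δ * Q ≤ 1 / 2 := by
    obtain ⟨x, hx0, hx⟩ := exists_norm_eq_one hm
    obtain ⟨y, hy⟩ := exists_norm_remainder_le_half η₀ x
    exact (hs₀ (x, y) hx0 (by simpa [hx] using hQ1)).trans hy
  have hlen : ∀ v ∈ T, ‖v.1‖ ≤ (2 * m + 1) * Q := by
    intro v hv
    rcases (hmin v hv).eq_or_lt with h | h
    · rw [← h]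
      nlinarith
    obtain ⟨_, η, hη, hr, hs⟩ := hT v hv
    have h1 := hs v₀ (by rintro h0; rw [h0, norm_zero] at hQ; linarith) h
    have h2 : η₀ ∈ Metric.closedBall η (2 * δ) := by
      rw [Metric.mem_closedBall] at *
      have := dist_triangle_right η₀ η ξ
      linarith
    have h3 := norm_remainder_le_of_mem h2 v₀
    have h4 : ε * Q ≤ δ * Q := by gcongr
    have h5 : δ * ‖v.1‖ ≤ δ * ((2 * m + 1) * Q) := by
      calc _ ≤ _ := h1
        _ ≤ _ := h3
        _ ≤ _ := by rw [← hQ]; linarith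
    exact le_of_mul_le_mul_left h5 hδ
  have hrem : ∀ v ∈ T, ‖remainder ξ v‖ ≤ (m + 1) * (2 * m + 1) * (δ * Q) := by
    intro v hv
    obtain ⟨_, η, hη, hr, hs⟩ := hT v hv
    have h1 := norm_remainder_le_of_mem hη v
    have h2 : ε * ‖v.1‖ ≤ δ * ‖v.1‖ := by gcongr
    have h3 : (m + 1) * δ * ‖v.1‖ ≤ (m + 1) * δ * ((2 * m + 1) * Q) := by
      have := hlen v hv
      gcongr
    linarith
  set B : ℝ := (2 * m + 1) * (m + 1) + 1 with hB
  have hB0 : 0 < B := by positivity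
  set f : IntPair m n → Fin m ⊕ Fin n → ℝ := fun v => Sum.elim
    (fun j => v.1 j / (2 * B * Q) + 1 / 2) (fun i => remainder ξ v i / (2 * B * (δ * Q)) + 1 / 2)
    with hf
  have key : ∀ {t c : ℝ}, 0 < c → |t| < B * c →
      0 ≤ t / (2 * B * c) + 1 / 2 ∧ t / (2 * B * c) + 1 / 2 < 1 := by
    intro t c hc ht
    have h0 : 0 < 2 * B * c := by positivity
    rw [abs_lt] at ht
    have h1 : -(1 / 2) < t / (2 * B * c) := by rw [lt_div_iff₀ h0]; linarith
    have h2 : t / (2 * B * c) < 1 / 2 := by rw [div_lt_iff₀ h0]; linarith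
    constructor <;> linarith
  obtain ⟨a, ha, b, hb, hab, hclose⟩ := exists_close_of_card_lt T f
    (s := 4 * ((2 * m + 1) * (m + 1) + 1) * (m + 1)) (by positivity) (by
      rintro v hv (j | i)
      · refine key hQ0 ((abs_intCast_le_norm v.1 j).trans_lt ((hlen v hv).trans_lt ?_))
        rw [hB]
        nlinarith [mul_pos hm0 hQ0]
      · refine key hδQ0 ((norm_le_pi_norm (remainder ξ v) i).trans_lt ((hrem v hv).trans_lt ?_))
        rw [hB]
        nlinarith) (by simpa [packingBound] using hcard)
  have key2 : ∀ {t u c : ℝ}, 0 < c → |(t / (2 * B * c) + 1 / 2) - (u / (2 * B * c) + 1 / 2)|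
      < 1 / (4 * B * (m + 1)) → |t - u| < c / (2 * (m + 1)) := by
    intro t u c hc h
    have h0 : 0 < 2 * B * c := by positivity
    have e : (t / (2 * B * c) + 1 / 2) - (u / (2 * B * c) + 1 / 2) = (t - u) / (2 * B * c) := by
      ring
    rw [e, abs_div, abs_of_pos h0, div_lt_iff₀ h0] at h
    refine h.trans_eq ?_
    field_simp
    norm_num
  set z := a - b with hz
  have hz0 : z ≠ 0 := sub_ne_zero.2 hab
  have hcast : ((4 * ((2 * m + 1) * (m + 1) + 1) * (m + 1) : ℕ) : ℝ) = 4 * B * (m + 1) := by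
    rw [hB]
    push_cast
    ring
  have hz1 : ‖z.1‖ < Q / (2 * (m + 1)) := by
    rw [pi_norm_lt_iff (by positivity)]
    intro j
    have := hclose (Sum.inl j)
    rw [hcast] at this
    have := key2 hQ0 this
    rw [Int.norm_eq_abs]
    simpa [hz] using this
  have hz2 : ‖remainder ξ z‖ < δ * Q / (2 * (m + 1)) := by
    rw [pi_norm_lt_iff (by positivity)]
    intro i
    have := hclose (Sum.inr i)
    rw [hcast] at this
    have := key2 hδQ0 this
    rw [hz, map_sub, Real.norm_eq_abs]
    exact this
  have hle : ∀ t : ℝ, 0 < t → t / (2 * (m + 1)) < t := by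
    intro t ht
    rw [div_lt_iff₀ (by positivity)]
    nlinarith
  by_cases h : z.1 = 0
  · have h1 := one_le_norm_remainder_of_fst_eq_zero ξ hz0 h
    have h2 := hle _ hδQ0
    linarith
  · have h1 := hs₀ z h (hz1.trans (hle _ hQ0))
    have h2 := norm_remainder_le_of_mem (Metric.mem_closedBall_comm.1 hη₀) z
    have h3 : m * δ * ‖z.1‖ ≤ m * δ * (Q / (2 * (m + 1))) := by gcongr
    have h4 : m * δ * (Q / (2 * (m + 1))) + δ * Q / (2 * (m + 1)) = δ * Q / 2 := by
      field_simp
    linarith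

theorem finite_dangerous (hm : 0 < m) {ξ : Fin n → Fin m → ℝ} {δ ε : ℝ} (hδ : 0 < δ)
    (hε : ε ≤ δ) : (dangerous ξ δ ε).Finite := by
  by_contra hinf
  obtain ⟨T, hT, hc⟩ := Set.Infinite.exists_subset_card_eq hinf (packingBound m n + 1)
  have := card_le_of_subset_dangerous hm hδ hε T (fun v hv => hT hv)
  omega

theorem card_bad_offsets_le {ι : Type*} [Fintype ι] [DecidableEq ι] {p : ℕ}
    (ξ : Fin n → Fin m → ℝ) {ε : ℝ} (hε : 0 < ε) (o : (ι → Fin p) → Fin n → Fin m → ℝ)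
    (D : Finset (IntPair m n)) (hD : ∀ v ∈ D, v.1 ≠ 0)
    (ho : ∀ x : Fin m → ℤ, x ≠ 0 → ∃ i₀ ρ, ∀ a b : ι → Fin p, (∀ i, i ≠ i₀ → a i = b i) →
      |∑ j, (o a ρ j - o b ρ j) * x j| = 3 * ε * |((a i₀ : ℕ) : ℝ) - (b i₀ : ℕ)| * ‖x‖)
    (S : Finset (ι → Fin p))
    (hS : ∀ a ∈ S, ∃ v ∈ D, ∃ η ∈ Metric.closedBall (ξ + o a) ε, ‖remainder η v‖ ≤ ε * ‖v.1‖) :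
    S.card ≤ D.card * ((m + 2) * p ^ (Fintype.card ι - 1)) := by
  classical
  have hsub : S ⊆ D.biUnion fun v => S.filter fun a =>
      ∃ η ∈ Metric.closedBall (ξ + o a) ε, ‖remainder η v‖ ≤ ε * ‖v.1‖ := by
    intro a ha
    obtain ⟨v, hv, h⟩ := hS a ha
    exact Finset.mem_biUnion.2 ⟨v, hv, Finset.mem_filter.2 ⟨ha, h⟩⟩
  refine (Finset.card_le_card hsub).trans (Finset.card_biUnion_le_card_mul _ _ _ ?_)
  intro v hv
  obtain ⟨i₀, ρ, hi⟩ := ho v.1 (hD v hv)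
  have hx := one_le_norm_of_ne_zero (hD v hv)
  refine card_le_of_fiber_bounded _ i₀ (m + 1) ?_
  have key : ∀ a, (∃ η ∈ Metric.closedBall (ξ + o a) ε, ‖remainder η v‖ ≤ ε * ‖v.1‖) →
      |remainder (ξ + o a) v ρ| ≤ (m + 1) * ε * ‖v.1‖ := by
    rintro a ⟨η, hη, hr⟩
    have h1 := norm_remainder_le_of_mem hη v
    have h2 := norm_le_pi_norm (remainder (ξ + o a) v) ρ
    rw [Real.norm_eq_abs] at h2
    linarith
  intro a ha b hb hab
  have h1 := key a (Finset.mem_filter.1 ha).2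
  have h2 := key b (Finset.mem_filter.1 hb).2
  have h3 := hi a b hab
  have h4 : remainder (ξ + o a) v ρ - remainder (ξ + o b) v ρ
      = ∑ j, (o a ρ j - o b ρ j) * v.1 j := by
    rw [remainder_sub_remainder_apply]
    refine Finset.sum_congr rfl fun j _ => ?_
    simp only [Pi.add_apply]
    ring
  rw [← h4] at h3
  have h5 := abs_sub (remainder (ξ + o a) v ρ) (remainder (ξ + o b) v ρ)
  have h6 : 0 < ε * ‖v.1‖ := by positivity
  have h7 : 3 * |((a i₀ : ℕ) : ℝ) - (b i₀ : ℕ)| ≤ 2 * (m + 1) := by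
    refine le_of_mul_le_mul_right ?_ h6
    linarith
  have h8 := le_abs_self (((a i₀ : ℕ) : ℝ) - (b i₀ : ℕ))
  have hm0 : (0 : ℝ) ≤ m := by positivity
  have h9 : ((a i₀ : ℕ) : ℝ) ≤ ((b i₀ : ℕ) : ℝ) + (m + 1) := by linarith
  exact_mod_cast h9

end Remainder

/-- The radius of the balls of level `k`. -/
noncomputable def scale (N k : ℕ) : ℝ := ((N : ℝ)⁻¹) ^ k

/-- The number of digits used for a step with prescribed direction. -/
def stepBound (m n : ℕ) : ℕ := (packingBound m n + 1) * (m + 2) + 1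

section Steps

variable {m n : ℕ}

theorem scale_pos {N : ℕ} (hN : 0 < N) (k : ℕ) : 0 < scale N k := by
  have : (0 : ℝ) < N := by exact_mod_cast hN
  unfold scale
  positivity

theorem scale_succ (N k : ℕ) : scale N (k + 1) = scale N k / N := by
  rw [scale, scale, pow_succ, div_eq_mul_inv]

theorem scale_add (N k l : ℕ) : scale N (k + l) = scale N k * scale N l := pow_add _ _ _

theorem scale_anti {N : ℕ} (hN : 0 < N) {k l : ℕ} (h : k ≤ l) : scale N l ≤ scale N k := by
  have : (1 : ℝ) ≤ N := by exact_mod_cast hN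
  exact pow_le_pow_of_le_one (by positivity) (inv_le_one_of_one_le₀ this) h

/-- No vector has an exceptionally small remainder at level `k`, unless some shorter vector already
has a small one. -/
def Safe (N k : ℕ) (ξ : Fin n → Fin m → ℝ) : Prop :=
  ∀ v : IntPair m n, 1 < ‖v.1‖ → ‖remainder ξ v‖ ≤ scale N (k + 1) * ‖v.1‖ →
    ∃ v' : IntPair m n, v'.1 ≠ 0 ∧ ‖v'.1‖ < ‖v.1‖ ∧ ‖remainder ξ v'‖ < scale N k * ‖v.1‖

/-- The ball of level `k'` around `ξ'` lies in the ball of level `k` around `ξ`, and all its points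
are safe at all levels in between. -/
def Advances (N k : ℕ) (ξ : Fin n → Fin m → ℝ) (k' : ℕ) (ξ' : Fin n → Fin m → ℝ) : Prop :=
  k ≤ k' ∧ Metric.closedBall ξ' (scale N k') ⊆ Metric.closedBall ξ (scale N k) ∧
    ∀ η ∈ Metric.closedBall ξ' (scale N k'), ∀ i, k ≤ i → i < k' → Safe N i η

theorem Advances.refl (N k : ℕ) (ξ : Fin n → Fin m → ℝ) : Advances N k ξ k ξ :=
  ⟨le_rfl, subset_rfl, fun _ _ _ h h' => absurd h' (not_lt.2 h)⟩

theorem Advances.trans {N k k' k'' : ℕ} {ξ ξ' ξ'' : Fin n → Fin m → ℝ}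
    (h : Advances N k ξ k' ξ') (h' : Advances N k' ξ' k'' ξ'') : Advances N k ξ k'' ξ'' := by
  refine ⟨h.1.trans h'.1, h'.2.1.trans h.2.1, fun η hη i hi hi' => ?_⟩
  rcases lt_or_ge i k' with h1 | h1
  · exact h.2.2 η (h'.2.1 hη) i hi h1
  · exact h'.2.2 η hη i h1 hi'

theorem advances_succ {N k : ℕ} {ξ ξ' : Fin n → Fin m → ℝ}
    (hsub : ‖ξ' - ξ‖ + scale N (k + 1) ≤ scale N k)
    (hgood : ∀ v ∈ dangerous ξ (scale N k) (scale N (k + 1)),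
      ∀ η ∈ Metric.closedBall ξ' (scale N (k + 1)), scale N (k + 1) * ‖v.1‖ < ‖remainder η v‖) :
    Advances N k ξ (k + 1) ξ' := by
  have hball : Metric.closedBall ξ' (scale N (k + 1)) ⊆ Metric.closedBall ξ (scale N k) := by
    refine Metric.closedBall_subset_closedBall' ?_
    rw [dist_eq_norm]
    linarith
  refine ⟨Nat.le_succ k, hball, fun η hη i hi hi' v hv hr => ?_⟩
  obtain rfl : i = k := by omega
  by_contra! hcon
  exact (hgood v ⟨hv, η, hball hη, hr, hcon⟩ η hη).not_ge hr

theorem finite_dangerous_scale (hm : 0 < m) {N : ℕ} (hN : 0 < N) (k : ℕ)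
    (ξ : Fin n → Fin m → ℝ) : (dangerous ξ (scale N k) (scale N (k + 1))).Finite :=
  finite_dangerous hm (scale_pos hN k) (scale_anti hN (Nat.le_succ k))

theorem ne_zero_of_mem_dangerous {ξ : Fin n → Fin m → ℝ} {δ ε : ℝ} {v : IntPair m n}
    (hv : v ∈ dangerous ξ δ ε) : v.1 ≠ 0 := by
  intro h
  have := hv.1
  rw [h, norm_zero] at this
  linarith

theorem exists_advances_succ_of_direction (hm : 0 < m) {N : ℕ} (hN : 12 * stepBound m n ≤ N)
    (k : ℕ) (ξ ζ : Fin n → Fin m → ℝ) (hζ : ‖ζ‖ ≤ scale N k / 4) (u : Fin n → ℝ) {ρ : Fin n}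
    (huρ : u ρ = 1) (hu : ∀ i, |u i| ≤ 1) (v₀ : IntPair m n) (hv₀ : v₀.1 ≠ 0) :
    ∃ z : Fin m → ℝ, (∀ j, |z j| ≤ 3 * stepBound m n * scale N (k + 1)) ∧
      Advances N k ξ (k + 1) (ξ + ζ + fun i j => u i * z j) ∧
      ∀ η ∈ Metric.closedBall (ξ + ζ + fun i j => u i * z j) (scale N (k + 1)),
        0 < ‖remainder η v₀‖ := by
  classical
  have hP : 1 ≤ stepBound m n := by unfold stepBound; omega
  have hN0 : 0 < N := by omega
  have hNr : (0 : ℝ) < N := by exact_mod_cast hN0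
  set δ := scale N k with hδ
  set ε := scale N (k + 1) with hε
  have hδ0 : 0 < δ := scale_pos hN0 k
  have hε0 : 0 < ε := scale_pos hN0 (k + 1)
  have hfin := finite_dangerous_scale hm hN0 k ξ
  set D := insert v₀ hfin.toFinset with hD
  have hDcard : D.card ≤ packingBound m n + 1 := by
    refine (Finset.card_insert_le _ _).trans (Nat.succ_le_succ ?_)
    exact card_le_of_subset_dangerous hm hδ0 (scale_anti hN0 (Nat.le_succ k)) _
      (fun v hv => hfin.mem_toFinset.1 hv)
  have hDne : ∀ v ∈ D, v.1 ≠ 0 := by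
    intro v hv
    rcases Finset.mem_insert.1 hv with rfl | hv
    · exact hv₀
    · exact ne_zero_of_mem_dangerous (hfin.mem_toFinset.1 hv)
  set o : (Fin m → Fin (stepBound m n)) → Fin n → Fin m → ℝ :=
    fun a => ζ + fun i j => u i * (3 * ε * (a j : ℕ)) with ho
  set S : Finset (Fin m → Fin (stepBound m n)) := Finset.univ.filter fun a =>
    ∃ v ∈ D, ∃ η ∈ Metric.closedBall (ξ + o a) ε, ‖remainder η v‖ ≤ ε * ‖v.1‖ with hS
  have hcard := card_bad_offsets_le ξ hε0 o D hDne (by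
    intro x hx
    obtain ⟨j₀, hj₀⟩ := exists_abs_eq_norm x hm
    refine ⟨j₀, ρ, fun a b hab => ?_⟩
    rw [Finset.sum_eq_single j₀]
    · simp only [ho, Pi.add_apply, huρ]
      rw [← hj₀, ← abs_of_pos (show 0 < 3 * ε by positivity), ← abs_mul, ← abs_mul,
        abs_of_pos (show 0 < 3 * ε by positivity)]
      congr 1
      ring
    · intro j _ hj
      simp only [ho, Pi.add_apply, hab j hj]
      ring
    · simp) S (fun a ha => (Finset.mem_filter.1 ha).2)
  have hlt : S.card < (Finset.univ : Finset (Fin m → Fin (stepBound m n))).card := by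
    rw [Finset.card_univ, Fintype.card_fun, Fintype.card_fin, Fintype.card_fin]
    rw [Fintype.card_fin] at hcard
    obtain ⟨m', rfl⟩ : ∃ m', m = m' + 1 := ⟨m - 1, by omega⟩
    rw [Nat.add_sub_cancel] at hcard
    calc S.card ≤ D.card * ((m' + 1 + 2) * stepBound (m' + 1) n ^ m') := hcard
      _ ≤ (packingBound (m' + 1) n + 1) * ((m' + 1 + 2) * stepBound (m' + 1) n ^ m') := by gcongr
      _ < stepBound (m' + 1) n * stepBound (m' + 1) n ^ m' := by
          rw [← mul_assoc]
          refine Nat.mul_lt_mul_of_pos_right ?_ (by positivity)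
          rw [stepBound]
          omega
      _ = stepBound (m' + 1) n ^ (m' + 1) := by rw [pow_succ]; ring
  obtain ⟨a, -, ha⟩ := Finset.exists_mem_notMem_of_card_lt_card hlt
  have ha' : ∀ v ∈ D, ∀ η ∈ Metric.closedBall (ξ + o a) ε, ε * ‖v.1‖ < ‖remainder η v‖ := by
    intro v hv η hη
    by_contra! h
    exact ha (Finset.mem_filter.2 ⟨Finset.mem_univ _, v, hv, η, hη, h⟩)
  have hz : ∀ j, |3 * ε * ((a j : ℕ) : ℝ)| ≤ 3 * stepBound m n * ε := by
    intro j
    rw [abs_of_nonneg (by positivity)]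
    have : ((a j : ℕ) : ℝ) ≤ stepBound m n := by exact_mod_cast (a j).2.le
    nlinarith
  have hoa : ξ + o a = ξ + ζ + fun i j => u i * (3 * ε * ((a j : ℕ) : ℝ)) := by
    simp only [ho, add_assoc]
  rw [hoa] at ha'
  refine ⟨fun j => 3 * ε * ((a j : ℕ) : ℝ), hz, advances_succ ?_ ?_, ?_⟩
  · have h1 : ξ + ζ + (fun i j => u i * (3 * ε * ((a j : ℕ) : ℝ))) - ξ
        = ζ + fun i j => u i * (3 * ε * ((a j : ℕ) : ℝ)) := by abel
    have h2 : ‖(fun i j => u i * (3 * ε * ((a j : ℕ) : ℝ)) : Fin n → Fin m → ℝ)‖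
        ≤ 3 * stepBound m n * ε := by
      refine matrix_norm_le (by positivity) fun i j => ?_
      rw [abs_mul]
      calc _ ≤ 1 * (3 * stepBound m n * ε) :=
            mul_le_mul (hu i) (hz j) (abs_nonneg _) zero_le_one
        _ = _ := one_mul _
    have h3 : 12 * stepBound m n * ε ≤ δ := by
      rw [hε, scale_succ, ← mul_div_assoc, div_le_iff₀ hNr, mul_comm]
      have : (12 * stepBound m n : ℝ) ≤ N := by exact_mod_cast hN
      gcongr
    have h4 : (1 : ℝ) ≤ stepBound m n := by exact_mod_cast hP
    have h5 : ε ≤ stepBound m n * ε := by nlinarith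
    rw [h1]
    have := norm_add_le ζ (fun i j => u i * (3 * ε * ((a j : ℕ) : ℝ)))
    linarith
  · intro v hv η hη
    exact ha' v (Finset.mem_insert_of_mem (hfin.mem_toFinset.2 hv)) η hη
  · intro η hη
    refine lt_of_le_of_lt (by positivity) (ha' v₀ (Finset.mem_insert_self _ _) η hη)

theorem exists_advances_of_direction (hm : 0 < m) {N : ℕ} (hN : 12 * stepBound m n ≤ N)
    (k : ℕ) (ξ ζ : Fin n → Fin m → ℝ) (hζ : ‖ζ‖ ≤ scale N k / 4) (u : Fin n → ℝ) {ρ : Fin n}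
    (huρ : u ρ = 1) (hu : ∀ i, |u i| ≤ 1) (T : ℕ) :
    ∃ z : Fin m → ℝ, Advances N k ξ (k + (T + 1)) (ξ + ζ + fun i j => u i * z j) := by
  obtain ⟨x, hx, -⟩ := exists_norm_eq_one hm
  have hN0 : 0 < N := by unfold stepBound at hN; omega
  induction T with
  | zero =>
    obtain ⟨z, -, hz, -⟩ := exists_advances_succ_of_direction hm hN k ξ ζ hζ u huρ hu (x, 0) hx
    exact ⟨z, hz⟩
  | succ T ih =>
    obtain ⟨z, hz⟩ := ih
    obtain ⟨z', -, hz', -⟩ := exists_advances_succ_of_direction hm hN (k + (T + 1))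
      (ξ + ζ + fun i j => u i * z j) 0 (by rw [norm_zero]; have := scale_pos hN0 (k + (T + 1)); positivity)
      u huρ hu (x, 0) hx
    refine ⟨z + z', ?_⟩
    have e : (ξ + ζ + fun i j => u i * (z + z') j)
        = (ξ + ζ + fun i j => u i * z j) + 0 + fun i j => u i * z' j := by
      funext i j
      simp only [Pi.add_apply, Pi.zero_apply]
      ring
    rw [e]
    exact hz.trans hz'

theorem exists_advances (hm : 0 < m) (hn : 0 < n) {N : ℕ} (hN : 12 * stepBound m n ≤ N)
    (k : ℕ) (ξ : Fin n → Fin m → ℝ) (T : ℕ) : ∃ ξ', Advances N k ξ (k + T) ξ' := by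
  have hN0 : 0 < N := by unfold stepBound at hN; omega
  rcases T with _ | T
  · exact ⟨ξ, Advances.refl N k ξ⟩
  · obtain ⟨z, hz⟩ := exists_advances_of_direction hm hN k ξ 0
      (by rw [norm_zero]; have := scale_pos hN0 k; positivity) (fun _ => 1) (ρ := ⟨0, hn⟩) rfl
      (by simp) T
    exact ⟨_, hz⟩

theorem exists_separated_advances (hm : 0 < m) (hn : 0 < n) {p : ℕ} (hp0 : 0 < p)
    (hp : 2 * (packingBound m n * (m + 2)) ≤ p) (k : ℕ) (ξ : Fin n → Fin m → ℝ) :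
    ∃ ch : Fin (p ^ (m * n) / 2) → Fin n → Fin m → ℝ,
      (∀ a, Advances (6 * p) k ξ (k + 1) (ch a)) ∧
      ∀ a b, a ≠ b → 3 * scale (6 * p) (k + 1) ≤ dist (ch a) (ch b) := by
  classical
  set N := 6 * p with hN
  have hN0 : 0 < N := by omega
  set δ := scale N k with hδ
  set ε := scale N (k + 1) with hε
  have hδ0 : 0 < δ := scale_pos hN0 k
  have hε0 : 0 < ε := scale_pos hN0 (k + 1)
  have hfin := finite_dangerous_scale hm hN0 k ξ
  set D := hfin.toFinset with hD
  have hDcard : D.card ≤ packingBound m n :=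
    card_le_of_subset_dangerous hm hδ0 (scale_anti hN0 (Nat.le_succ k)) _
      (fun v hv => hfin.mem_toFinset.1 hv)
  set o : (Fin n × Fin m → Fin p) → Fin n → Fin m → ℝ :=
    fun a i j => 3 * ε * (a (i, j) : ℕ) with ho
  set S : Finset (Fin n × Fin m → Fin p) := Finset.univ.filter fun a =>
    ∃ v ∈ D, ∃ η ∈ Metric.closedBall (ξ + o a) ε, ‖remainder η v‖ ≤ ε * ‖v.1‖ with hS
  have hcard := card_bad_offsets_le ξ hε0 o D
    (fun v hv => ne_zero_of_mem_dangerous (hfin.mem_toFinset.1 hv)) (by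
    intro x hx
    obtain ⟨j₀, hj₀⟩ := exists_abs_eq_norm x hm
    refine ⟨(⟨0, hn⟩, j₀), ⟨0, hn⟩, fun a b hab => ?_⟩
    rw [Finset.sum_eq_single j₀]
    · simp only [ho]
      rw [← hj₀, ← abs_of_pos (show 0 < 3 * ε by positivity), ← abs_mul, ← abs_mul,
        abs_of_pos (show 0 < 3 * ε by positivity)]
      congr 1
      ring
    · intro j _ hj
      simp only [ho, hab (⟨0, hn⟩, j) (by simpa using hj)]
      ring
    · simp) S (fun a ha => (Finset.mem_filter.1 ha).2)
  have hgood : p ^ (m * n) / 2 ≤ Sᶜ.card := by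
    rw [Finset.card_compl, Fintype.card_fun, Fintype.card_fin]
    rw [Fintype.card_prod, Fintype.card_fin, Fintype.card_fin, mul_comm n m] at *
    obtain ⟨t, ht⟩ : ∃ t, m * n = t + 1 := ⟨m * n - 1, by have := Nat.mul_pos hm hn; omega⟩
    rw [ht] at hcard ⊢
    rw [Nat.add_sub_cancel] at hcard
    have h1 : 2 * S.card ≤ p ^ (t + 1) := by
      calc 2 * S.card ≤ 2 * (D.card * ((m + 2) * p ^ t)) := by gcongr
        _ ≤ 2 * (packingBound m n * ((m + 2) * p ^ t)) := by gcongr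
        _ = 2 * (packingBound m n * (m + 2)) * p ^ t := by ring
        _ ≤ p * p ^ t := by gcongr
        _ = p ^ (t + 1) := by rw [pow_succ]; ring
    omega
  obtain ⟨S', hS', hS'c⟩ := Finset.exists_subset_card_eq hgood
  let e := S'.equivFinOfCardEq hS'c
  refine ⟨fun a => ξ + o (e.symm a), fun a => ?_, fun a b hab => ?_⟩
  · have hmem : (e.symm a : Fin n × Fin m → Fin p) ∉ S :=
      Finset.mem_compl.1 (hS' (e.symm a).2)
    refine advances_succ ?_ ?_
    · rw [add_sub_cancel_left]
      have h1 : ‖o (e.symm a)‖ ≤ 3 * ε * p := by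
        refine matrix_norm_le (by positivity) fun i j => ?_
        rw [ho, abs_of_nonneg (by positivity)]
        have : (((e.symm a).1 (i, j) : ℕ) : ℝ) ≤ p := by exact_mod_cast (Fin.is_lt _).le
        exact mul_le_mul_of_nonneg_left this (by positivity)
      have h2 : 6 * p * ε = δ := by
        rw [hε, scale_succ, hN]
        have : (p : ℝ) ≠ 0 := by exact_mod_cast hp0.ne'
        push_cast
        field_simp
        rfl
      have h3 : (1 : ℝ) ≤ p := by exact_mod_cast hp0
      nlinarith
    · intro v hv η hη
      by_contra! h
      exact hmem (Finset.mem_filter.2 ⟨Finset.mem_univ _, v, hfin.mem_toFinset.2 hv, η, hη, h⟩)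
  · have hne : (e.symm a : Fin n × Fin m → Fin p) ≠ e.symm b := fun h =>
      hab (e.symm.injective (Subtype.ext h))
    obtain ⟨⟨i, j⟩, hij⟩ := Function.ne_iff.1 hne
    rw [dist_add_left, dist_eq_norm]
    refine le_trans ?_ (abs_entry_le_norm _ i j)
    simp only [ho, Pi.sub_apply]
    rw [← mul_sub, abs_mul, abs_of_pos (show 0 < 3 * ε by positivity)]
    refine le_mul_of_one_le_right (by positivity) ?_
    have h1 : (((e.symm a).1 (i, j) : ℕ) : ℤ) - ((e.symm b).1 (i, j) : ℕ) ≠ 0 := by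
      intro h
      apply hij
      ext
      omega
    have h2 := Int.one_le_abs h1
    exact_mod_cast h2

end Steps

section QuantitativeIndependence

variable {V E J : Type*} [AddCommGroup V] [NormedAddCommGroup E] [NormedSpace ℝ E] [Fintype J]

theorem exists_common_denominator (c : J → ℝ) {s : ℕ} (hs : 0 < s) :
    ∃ q : ℤ, q ≠ 0 ∧ |q| ≤ (s ^ Fintype.card J : ℕ) ∧
      ∃ p : J → ℤ, ∀ j, |c j * q - p j| < 1 / s := by
  obtain ⟨q, hq, hqA, p, hp⟩ := dirichlet_linear_forms (ι := J) (κ := Unit) (fun j _ => c j)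
    (A := s ^ Fintype.card J) hs (by simp)
  refine ⟨q (), fun h => hq (funext fun _ => h), hqA (), p, fun j => ?_⟩
  simpa using hp j

theorem norm_sum_smul_lt [Nonempty J] {x : J → E} {g l : ℝ} {s : ℕ} (hs : 0 < s) (hl : 0 < l)
    (hx : ∀ j, ‖x j‖ ≤ g * l) (hg : 2 * Fintype.card J * g ≤ s) {b : J → ℝ}
    (hb : ∀ j, |b j| < 1 / s) : ‖∑ j, b j • x j‖ ≤ l / 2 := by
  have hs' : (0 : ℝ) < s := by exact_mod_cast hs
  calc ‖∑ j, b j • x j‖ ≤ ∑ j, ‖b j • x j‖ := norm_sum_le _ _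
    _ ≤ ∑ _j : J, 1 / s * (g * l) := by
        refine Finset.sum_le_sum fun j _ => ?_
        rw [norm_smul, Real.norm_eq_abs]
        exact mul_le_mul (hb j).le (hx j) (norm_nonneg _) (by positivity)
    _ = Fintype.card J * g * l / s := by
        simp only [Finset.sum_const, Finset.card_univ, nsmul_eq_mul]
        ring
    _ ≤ l / 2 := by
        rw [div_le_iff₀ hs']
        nlinarith

variable (f : V →ₗ[ℤ] E) {l g : ℝ} {s : ℕ} {w : J → V}

/-- Integrally independent short vectors are quantitatively independent over the reals. -/
theorem mul_norm_le_norm_sum_smul [Nonempty J] (hs : 0 < s) (hl : 0 < l)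
    (hf : ∀ v, v ≠ 0 → l ≤ ‖f v‖) (hw : LinearIndependent ℤ w) (hwg : ∀ j, ‖f (w j)‖ ≤ g * l)
    (hg : 2 * Fintype.card J * g ≤ s) (c : J → ℝ) :
    l * ‖c‖ ≤ 2 * (s : ℝ) ^ Fintype.card J * ‖∑ j, c j • f (w j)‖ := by
  by_cases hc : c = 0
  · simp [hc]
  obtain ⟨j₀, hj₀⟩ : ∃ j₀, |c j₀| = ‖c‖ := by
    obtain ⟨j, hj⟩ := Finite.exists_max (fun j => |c j|)
    refine ⟨j, le_antisymm (norm_le_pi_norm c j) ?_⟩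
    rw [pi_norm_le_iff_of_nonneg (abs_nonneg _)]
    exact hj
  have hcpos : 0 < ‖c‖ := norm_pos_iff.2 hc
  have hc0 : c j₀ ≠ 0 := by
    intro h
    rw [h, abs_zero] at hj₀
    linarith
  obtain ⟨q, hq, hqA, p, hp⟩ := exists_common_denominator (fun j => c j / c j₀) hs
  have hs' : (1 : ℝ) ≤ s := by exact_mod_cast hs
  have hpj : p j₀ ≠ 0 := by
    intro h
    have := hp j₀
    rw [h, div_self hc0] at this
    have h1 : (1 : ℝ) ≤ |(q : ℝ)| := by exact_mod_cast Int.one_le_abs hq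
    have h2 : 1 / (s : ℝ) ≤ 1 := by
      rw [div_le_one (by linarith)]
      exact hs'
    simp only [one_mul, Int.cast_zero, sub_zero] at this
    linarith
  have hne : ∑ j, p j • w j ≠ 0 := fun h =>
    hpj (Fintype.linearIndependent_iff.1 hw p h j₀)
  have h1 := hf _ hne
  have h2 := norm_sum_smul_lt (x := fun j => f (w j)) hs hl hwg hg hp
  have e : (q / c j₀) • ∑ j, c j • f (w j)
      = f (∑ j, p j • w j) + ∑ j, (c j / c j₀ * q - p j) • f (w j) := by
    rw [map_sum, Finset.smul_sum, ← Finset.sum_add_distrib]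
    refine Finset.sum_congr rfl fun j _ => ?_
    rw [map_smul, ← Int.cast_smul_eq_zsmul ℝ, ← add_smul, smul_smul]
    congr 1
    ring
  have h3 : l / 2 ≤ ‖(q / c j₀) • ∑ j, c j • f (w j)‖ := by
    rw [e]
    have := norm_sub_le_norm_add (f (∑ j, p j • w j)) (∑ j, (c j / c j₀ * q - p j) • f (w j))
    linarith
  rw [norm_smul, norm_div, Real.norm_eq_abs, Real.norm_eq_abs, hj₀, div_mul_eq_mul_div,
    le_div_iff₀ hcpos] at h3
  have h4 : |(q : ℝ)| ≤ (s : ℝ) ^ Fintype.card J := by exact_mod_cast hqA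
  have h5 : |(q : ℝ)| * ‖∑ j, c j • f (w j)‖
      ≤ (s : ℝ) ^ Fintype.card J * ‖∑ j, c j • f (w j)‖ := by gcongr
  linarith

theorem exists_denominator_of_dependent [Nonempty J] (hs : 0 < s) (hl : 0 < l)
    (hf : ∀ v, v ≠ 0 → l ≤ ‖f v‖) (hwg : ∀ j, ‖f (w j)‖ ≤ g * l)
    (hg : 2 * Fintype.card J * g ≤ s) {v : V} {c₀ : ℤ} (hc₀ : c₀ ≠ 0) {c : J → ℤ}
    (hv : c₀ • v = ∑ j, c j • w j) :
    ∃ q : ℤ, q ≠ 0 ∧ |q| ≤ (s ^ Fintype.card J : ℕ) ∧ ∃ p : J → ℤ, q • v = ∑ j, p j • w j := by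
  have hc₀' : (c₀ : ℝ) ≠ 0 := by exact_mod_cast hc₀
  obtain ⟨q, hq, hqA, p, hp⟩ := exists_common_denominator (fun j => (c j : ℝ) / c₀) hs
  refine ⟨q, hq, hqA, p, ?_⟩
  by_contra hne
  have h1 := hf _ (sub_ne_zero.2 hne)
  have h2 := norm_sum_smul_lt (x := fun j => f (w j)) hs hl hwg hg hp
  have hfv : f v = ∑ j, ((c j : ℝ) / c₀) • f (w j) := by
    have h3 := congrArg f hv
    rw [map_smul, map_sum, ← Int.cast_smul_eq_zsmul ℝ] at h3
    have h4 := congrArg (fun x => (c₀ : ℝ)⁻¹ • x) h3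
    simp only [smul_smul, inv_mul_cancel₀ hc₀', one_smul] at h4
    rw [h4, Finset.smul_sum]
    refine Finset.sum_congr rfl fun j _ => ?_
    rw [map_smul, ← Int.cast_smul_eq_zsmul ℝ, smul_smul]
    congr 1
    field_simp
  have e : f (q • v - ∑ j, p j • w j) = ∑ j, ((c j : ℝ) / c₀ * q - p j) • f (w j) := by
    rw [map_sub, map_smul, map_sum, hfv, ← Int.cast_smul_eq_zsmul ℝ, Finset.smul_sum,
      ← Finset.sum_sub_distrib]
    refine Finset.sum_congr rfl fun j _ => ?_
    rw [map_smul, ← Int.cast_smul_eq_zsmul ℝ, smul_smul, ← sub_smul]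
    congr 1
    ring
  rw [e] at h1
  linarith

theorem exists_functional [Nonempty J] (hs : 0 < s) (hl : 0 < l)
    (hf : ∀ v, v ≠ 0 → l ≤ ‖f v‖) (hw : LinearIndependent ℤ w) (hwg : ∀ j, ‖f (w j)‖ ≤ g * l)
    (hg : 2 * Fintype.card J * g ≤ s) (e : J → ℝ) (he : ∀ j, |e j| ≤ 1) :
    ∃ φ : E →L[ℝ] ℝ, (∀ j, φ (f (w j)) = e j) ∧
      ‖φ‖ ≤ Fintype.card J * (2 * (s : ℝ) ^ Fintype.card J) / l := by
  classical
  let T : (J → ℝ) →ₗ[ℝ] E := Fintype.linearCombination ℝ (fun j => f (w j))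
  have hT : ∀ c, T c = ∑ j, c j • f (w j) := fun c => rfl
  have hQ := mul_norm_le_norm_sum_smul f hs hl hf hw hwg hg
  have hinj : Function.Injective T := by
    rw [← LinearMap.ker_eq_bot, LinearMap.ker_eq_bot']
    intro c hc
    have := hQ c
    rw [← hT, hc, norm_zero, mul_zero] at this
    have h2 : ‖c‖ ≤ 0 := by
      by_contra! h
      have := mul_pos hl h
      linarith
    exact norm_le_zero_iff.1 h2
  let T' := LinearEquiv.ofInjective T hinj
  let φ₀ : LinearMap.range T →ₗ[ℝ] ℝ := (Fintype.linearCombination ℝ e).comp T'.symm.toLinearMap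
  have hφ₀ : ∀ c, φ₀ (T' c) = ∑ j, c j * e j := by
    intro c
    simp [φ₀, Fintype.linearCombination_apply]
  set C : ℝ := Fintype.card J * (2 * (s : ℝ) ^ Fintype.card J) / l with hC
  have hC0 : 0 ≤ C := by positivity
  have hbound : ∀ x, ‖φ₀ x‖ ≤ C * ‖x‖ := by
    intro x
    obtain ⟨c, rfl⟩ := T'.surjective x
    have h1 : ‖T' c‖ = ‖∑ j, c j • f (w j)‖ := rfl
    rw [hφ₀, h1, hC, div_mul_eq_mul_div, le_div_iff₀ hl]
    have h2 : ‖∑ j, c j * e j‖ ≤ Fintype.card J * ‖c‖ := by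
      refine (norm_sum_le _ _).trans ?_
      calc _ ≤ ∑ _j : J, ‖c‖ := by
            refine Finset.sum_le_sum fun j _ => ?_
            rw [norm_mul]
            have h3 := norm_le_pi_norm c j
            calc _ ≤ ‖c‖ * 1 := mul_le_mul h3 (he j) (abs_nonneg _) (norm_nonneg _)
              _ = ‖c‖ := mul_one _
        _ = _ := by simp
    have h3 := hQ c
    have h4 : (0 : ℝ) ≤ Fintype.card J := by positivity
    nlinarith
  obtain ⟨φ, hφ, hφn⟩ := exists_extension_norm_eq _ (φ₀.mkContinuous C hbound)
  refine ⟨φ, fun j => ?_, ?_⟩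
  · have h1 := hφ (T' (Pi.single j 1))
    have h2 : (T' (Pi.single j 1) : E) = f (w j) := by
      change T (Pi.single j 1) = _
      simp [hT, Pi.single_apply]
    rw [h2] at h1
    rw [h1]
    change φ₀ _ = _
    rw [hφ₀]
    simp [Pi.single_apply]
  · rw [hφn]
    exact LinearMap.mkContinuous_norm_le _ hC0 _

end QuantitativeIndependence

section Lattice

variable {m n : ℕ}

/-- The vector `(𝒙, δ⁻¹(ξ𝒙 - 𝒚))`. -/
noncomputable def latVec (ξ : Fin n → Fin m → ℝ) (δ : ℝ) :
    IntPair m n →ₗ[ℤ] (Fin m → ℝ) × (Fin n → ℝ) :=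
  AddMonoidHom.toIntLinearMap <| AddMonoidHom.mk'
    (fun v => ((fun j => (v.1 j : ℝ)), δ⁻¹ • remainder ξ v)) <| by
    intro v w
    refine Prod.ext ?_ ?_
    · funext j
      simp
    · simp [smul_add]

theorem latVec_apply (ξ : Fin n → Fin m → ℝ) (δ : ℝ) (v : IntPair m n) :
    latVec ξ δ v = ((fun j => (v.1 j : ℝ)), δ⁻¹ • remainder ξ v) := rfl

theorem norm_intCast (x : Fin m → ℤ) : ‖(fun j => (x j : ℝ))‖ = ‖x‖ := by
  refine le_antisymm ?_ ?_
  · rw [pi_norm_le_iff_of_nonneg (norm_nonneg _)]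
    exact abs_intCast_le_norm x
  · rw [pi_norm_le_iff_of_nonneg (norm_nonneg _)]
    intro j
    rw [Int.norm_eq_abs]
    exact norm_le_pi_norm (fun j => (x j : ℝ)) j

theorem norm_latVec (ξ : Fin n → Fin m → ℝ) {δ : ℝ} (hδ : 0 < δ) (v : IntPair m n) :
    ‖latVec ξ δ v‖ = max ‖v.1‖ (δ⁻¹ * ‖remainder ξ v‖) := by
  rw [latVec_apply, Prod.norm_def, norm_intCast, norm_smul, Real.norm_eq_abs,
    abs_of_pos (inv_pos.2 hδ)]

theorem norm_fst_le_latVec (ξ : Fin n → Fin m → ℝ) {δ : ℝ} (hδ : 0 < δ) (v : IntPair m n) :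
    ‖v.1‖ ≤ ‖latVec ξ δ v‖ := by
  rw [norm_latVec ξ hδ]
  exact le_max_left _ _

theorem norm_remainder_le_latVec (ξ : Fin n → Fin m → ℝ) {δ : ℝ} (hδ : 0 < δ)
    (v : IntPair m n) : ‖remainder ξ v‖ ≤ δ * ‖latVec ξ δ v‖ := by
  rw [norm_latVec ξ hδ, ← div_le_iff₀' hδ, div_eq_inv_mul]
  exact le_max_right _ _

theorem norm_latVec_le {ξ : Fin n → Fin m → ℝ} {δ c : ℝ} (hδ : 0 < δ) {v : IntPair m n}
    (h1 : ‖v.1‖ ≤ c) (h2 : ‖remainder ξ v‖ ≤ δ * c) : ‖latVec ξ δ v‖ ≤ c := by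
  rw [norm_latVec ξ hδ, max_le_iff, ← div_eq_inv_mul, div_le_iff₀' hδ]
  exact ⟨h1, h2⟩

/-- The length of the shortest nonzero vector of the lattice attached to `ξ` and `δ`. -/
noncomputable def lam (ξ : Fin n → Fin m → ℝ) (δ : ℝ) : ℝ :=
  ⨅ v : {v : IntPair m n // v ≠ 0}, ‖latVec ξ δ v‖

theorem lam_le (ξ : Fin n → Fin m → ℝ) (δ : ℝ) {v : IntPair m n} (hv : v ≠ 0) :
    lam ξ δ ≤ ‖latVec ξ δ v‖ :=
  ciInf_le ⟨0, by rintro _ ⟨v, rfl⟩; exact norm_nonneg _⟩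
    (⟨v, hv⟩ : {v : IntPair m n // v ≠ 0})

theorem one_le_norm_latVec (ξ : Fin n → Fin m → ℝ) {δ : ℝ} (hδ : 0 < δ) (hδ1 : δ ≤ 1)
    {v : IntPair m n} (hv : v ≠ 0) : 1 ≤ ‖latVec ξ δ v‖ := by
  by_cases h : v.1 = 0
  · have h1 := one_le_norm_remainder_of_fst_eq_zero ξ hv h
    have h2 := norm_remainder_le_latVec ξ hδ v
    have h3 := norm_nonneg (latVec ξ δ v)
    nlinarith
  · exact (one_le_norm_of_ne_zero h).trans (norm_fst_le_latVec ξ hδ v)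

theorem nonempty_ne_zero (hm : 0 < m) : Nonempty {v : IntPair m n // v ≠ 0} := by
  obtain ⟨x, hx, -⟩ := exists_norm_eq_one hm
  exact ⟨⟨(x, 0), fun h => hx (congrArg Prod.fst h)⟩⟩

theorem one_le_lam (hm : 0 < m) (ξ : Fin n → Fin m → ℝ) {δ : ℝ} (hδ : 0 < δ) (hδ1 : δ ≤ 1) :
    1 ≤ lam ξ δ := by
  have := nonempty_ne_zero (m := m) (n := n) hm
  exact le_ciInf fun v => one_le_norm_latVec ξ hδ hδ1 v.2

theorem exists_norm_latVec_lt (hm : 0 < m) {ξ : Fin n → Fin m → ℝ} {δ c : ℝ} (h : lam ξ δ < c) :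
    ∃ v, v ≠ 0 ∧ ‖latVec ξ δ v‖ < c := by
  have := nonempty_ne_zero (m := m) (n := n) hm
  obtain ⟨v, hv⟩ := exists_lt_of_ciInf_lt h
  exact ⟨v, v.2, hv⟩

/-- The vectors of length at most `G` times the minimum span a space of dimension at most `r`. -/
def RankLE (ξ : Fin n → Fin m → ℝ) (δ : ℝ) (r : ℕ) (G : ℝ) : Prop :=
  ∀ w : Fin (r + 1) → IntPair m n, LinearIndependent ℤ w →
    ∃ j, G * lam ξ δ < ‖latVec ξ δ (w j)‖

end Lattice

section RankDrop

variable {m n : ℕ}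

theorem exists_int_ne_zero_abs_sub_le_one (t : ℝ) : ∃ k : ℤ, k ≠ 0 ∧ |(k : ℝ) - t| ≤ 1 := by
  rcases le_or_gt 0 t with h | h
  · refine ⟨⌊t⌋ + 1, ?_, ?_⟩
    · have := Int.floor_nonneg.2 h
      omega
    · have h1 := Int.floor_le t
      have h2 := Int.lt_floor_add_one t
      push_cast
      rw [abs_le]
      constructor <;> linarith
  · refine ⟨⌈t⌉ - 1, ?_, ?_⟩
    · have : ⌈t⌉ ≤ 0 := Int.ceil_le.2 (by simpa using h.le)
      omega
    · have h1 := Int.le_ceil t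
      have h2 := Int.ceil_lt_add_one t
      push_cast
      rw [abs_le]
      constructor <;> linarith

/-- The bound for the functionals of `exists_functional`. -/
noncomputable def functionalBound (r s : ℕ) : ℝ := (r + 1) * (2 * (s : ℝ) ^ (r + 1))

theorem exists_direction (hm : 0 < m) (ξ : Fin n → Fin m → ℝ) {δ : ℝ} (hδ : 0 < δ) (hδ1 : δ ≤ 1)
    {r s : ℕ} {g : ℝ} (hs : 0 < s) (hg : 2 * (r + 1) * g ≤ s) (w : Fin (r + 1) → IntPair m n)
    (hw : LinearIndependent ℤ w) (hwg : ∀ j, ‖latVec ξ δ (w j)‖ ≤ g * lam ξ δ) {ρ τ : Fin n}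
    (hρτ : ρ ≠ τ) :
    ∃ (β u : Fin n → ℝ) (ζ : Fin n → Fin m → ℝ) (k : Fin (r + 1) → ℤ),
      ‖ζ‖ ≤ δ / 4 ∧ u ρ = 1 ∧ (∀ i, |u i| ≤ 1) ∧ (∀ i, |β i| ≤ β τ) ∧ 0 < β τ ∧
      β τ * lam ξ δ ≤ 6 * functionalBound r s ∧
      (∀ j, k j ≠ 0 ∧ |(k j : ℝ)| ≤ 5 * functionalBound r s * g + 1) ∧
      ∀ (z : Fin m → ℝ) (j : Fin (r + 1)),
        ∑ i, β i * (δ⁻¹ * remainder (ξ + ζ + fun i j => u i * z j) (w j) i) = k j := by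
  classical
  set l := lam ξ δ with hl
  have hl0 : 0 < l := zero_lt_one.trans_le (one_le_lam hm ξ hδ hδ1)
  set C := functionalBound r s with hC
  have hC0 : 0 < C := by
    have : (0 : ℝ) < s := by exact_mod_cast hs
    rw [hC, functionalBound]
    positivity
  choose k hk0 hk using fun j =>
    exists_int_ne_zero_abs_sub_le_one (5 * C / l * (δ⁻¹ * remainder ξ (w j) τ))
  obtain ⟨φ, hφ, hφn⟩ := exists_functional (latVec ξ δ) hs hl0 (fun v hv => lam_le ξ δ hv) hw hwg
    (by simpa using hg) (fun j => (k j : ℝ) - 5 * C / l * (δ⁻¹ * remainder ξ (w j) τ)) hk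
  have hφC : ‖φ‖ ≤ C / l := by
    rw [hC, functionalBound]
    simpa using hφn
  set α : Fin m → ℝ := fun j => φ (Pi.single j 1, 0) with hα
  set β' : Fin n → ℝ := fun i => φ (0, Pi.single i 1) with hβ'
  have hnorm1 : ∀ {q : ℕ} (i : Fin q), ‖(Pi.single i 1 : Fin q → ℝ)‖ ≤ 1 := by
    intro q i
    rw [pi_norm_le_iff_of_nonneg zero_le_one]
    intro i'
    by_cases h : i' = i <;> simp [h]
  have hαle : ∀ j, |α j| ≤ C / l := by
    intro j
    refine (φ.le_opNorm _).trans ?_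
    rw [Prod.norm_mk, norm_zero, max_eq_left (norm_nonneg _)]
    have := hnorm1 j
    have := norm_nonneg φ
    nlinarith
  have hβle : ∀ i, |β' i| ≤ C / l := by
    intro i
    refine (φ.le_opNorm _).trans ?_
    rw [Prod.norm_mk, norm_zero, max_eq_right (norm_nonneg _)]
    have := hnorm1 i
    have := norm_nonneg φ
    nlinarith
  have hφ' : ∀ x y, φ (x, y) = ∑ j, α j * x j + ∑ i, β' i * y i := by
    intro x y
    have h1 : ((x, y) : (Fin m → ℝ) × (Fin n → ℝ)) = ∑ j, x j • (Pi.single j 1, 0)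
        + ∑ i, y i • (0, Pi.single i 1) := by
      refine Prod.ext ?_ ?_
      · simp only [Prod.fst_add, Prod.fst_sum, Prod.smul_fst, smul_zero, Finset.sum_const_zero,
          add_zero]
        exact pi_eq_sum_univ' x
      · simp only [Prod.snd_add, Prod.snd_sum, Prod.smul_snd, smul_zero, Finset.sum_const_zero,
          zero_add]
        exact pi_eq_sum_univ' y
    rw [h1, map_add, map_sum, map_sum]
    simp only [map_smul, smul_eq_mul, mul_comm, hα, hβ']
  have hCl : 0 < C / l := by positivity
  set β : Fin n → ℝ := fun i => β' i + if i = τ then 5 * C / l else 0 with hβ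
  have h5 : 5 * C / l = 5 * (C / l) := by ring
  have hβτ : 4 * (C / l) ≤ β τ := by
    have := (abs_le.1 (hβle τ)).1
    simp only [hβ, if_true, h5]
    linarith
  have hβτ' : β τ ≤ 6 * (C / l) := by
    have := (abs_le.1 (hβle τ)).2
    simp only [hβ, if_true, h5]
    linarith
  have hβτ0 : 0 < β τ := by linarith
  have hβi : ∀ i, |β i| ≤ β τ := by
    intro i
    by_cases h : i = τ
    · rw [h, abs_of_pos hβτ0]
    · have := hβle i
      simp only [hβ, h, if_false, add_zero] at hβτ ⊢
      linarith
  refine ⟨β, Pi.single ρ 1 + Pi.single τ (-(β ρ / β τ)), fun i j => if i = τ then δ * α j / β τ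
    else 0, k, ?_, ?_, ?_, hβi, hβτ0, ?_, fun j => ⟨hk0 j, ?_⟩, ?_⟩
  · refine matrix_norm_le (by positivity) fun i j => ?_
    split_ifs
    · rw [abs_div, abs_mul, abs_of_pos hδ, abs_of_pos hβτ0, div_le_div_iff₀ hβτ0 (by norm_num)]
      have := hαle j
      nlinarith
    · rw [abs_zero]
      positivity
  · simp [hρτ]
  · intro i
    by_cases h1 : i = ρ
    · simp [h1, hρτ]
    · by_cases h2 : i = τ
      · subst h2
        simp only [Pi.add_apply, Pi.single_eq_of_ne h1, Pi.single_eq_same, zero_add, abs_neg,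
          abs_div]
        rw [abs_of_pos hβτ0, div_le_one hβτ0]
        exact hβi ρ
      · simp [h1, h2]
  · calc β τ * l ≤ 6 * (C / l) * l := by gcongr
      _ = 6 * C := by field_simp
  · have h1 : |5 * C / l * (δ⁻¹ * remainder ξ (w j) τ)| ≤ 5 * C * g := by
      have h2 : |δ⁻¹ * remainder ξ (w j) τ| ≤ g * l := by
        rw [abs_mul, abs_of_pos (inv_pos.2 hδ)]
        refine le_trans ?_ (hwg j)
        rw [norm_latVec ξ hδ]
        refine le_trans ?_ (le_max_right _ _)
        gcongr
        exact norm_le_pi_norm (remainder ξ (w j)) τ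
      rw [abs_mul, abs_of_pos (show 0 < 5 * C / l by positivity)]
      calc _ ≤ 5 * C / l * (g * l) := by gcongr
        _ = 5 * C * g := by field_simp
    have h2 := abs_sub_abs_le_abs_sub (k j : ℝ) (5 * C / l * (δ⁻¹ * remainder ξ (w j) τ))
    have h3 := hk j
    linarith
  · intro z j
    set u : Fin n → ℝ := Pi.single ρ 1 + Pi.single τ (-(β ρ / β τ)) with hu
    have hβu : ∑ i, β i * u i = 0 := by
      simp only [hu, Pi.add_apply, mul_add, Finset.sum_add_distrib, Pi.single_apply, mul_ite,
        mul_one, mul_zero, Finset.sum_ite_eq', Finset.mem_univ, if_true]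
      field_simp
      ring
    have hrem : ∀ i, remainder (ξ + (fun i j => if i = τ then δ * α j / β τ else 0)
        + fun i j => u i * z j) (w j) i = remainder ξ (w j) i
          + (if i = τ then δ / β τ * ∑ j', α j' * (w j).1 j' else 0)
          + u i * ∑ j', z j' * (w j).1 j' := by
      intro i
      rw [remainder_add_apply, remainder_add_apply]
      congr 1
      · congr 1
        split_ifs
        · rw [Finset.mul_sum]
          exact Finset.sum_congr rfl fun j' _ => by ring
        · simp
      · rw [Finset.mul_sum]
        exact Finset.sum_congr rfl fun j' _ => by ring
    have hsum : ∑ i, β i * (δ⁻¹ * remainder (ξ + (fun i j => if i = τ then δ * α j / β τ else 0)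
        + fun i j => u i * z j) (w j) i)
        = ∑ i, β i * (δ⁻¹ * remainder ξ (w j) i) + ∑ j', α j' * ((w j).1 j' : ℝ)
          + δ⁻¹ * (∑ j', z j' * ((w j).1 j' : ℝ)) * ∑ i, β i * u i := by
      have h2 : ∑ j', α j' * ((w j).1 j' : ℝ) = ∑ i, (if i = τ then
          β i * (δ⁻¹ * (δ / β τ * ∑ j', α j' * ((w j).1 j' : ℝ))) else 0) := by
        rw [Finset.sum_ite_eq' Finset.univ τ, if_pos (Finset.mem_univ _)]
        field_simp
      rw [h2, Finset.mul_sum Finset.univ (fun i => β i * u i), ← Finset.sum_add_distrib,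
        ← Finset.sum_add_distrib]
      refine Finset.sum_congr rfl fun i _ => ?_
      rw [hrem i]
      split_ifs <;> ring
    rw [hsum, hβu, mul_zero, add_zero]
    have h3 := hφ j
    rw [latVec_apply, hφ'] at h3
    have h4 : ∑ i, β i * (δ⁻¹ * remainder ξ (w j) i)
        = ∑ i, β' i * (δ⁻¹ • remainder ξ (w j)) i + 5 * C / l * (δ⁻¹ * remainder ξ (w j) τ) := by
      have h6 : 5 * C / l * (δ⁻¹ * remainder ξ (w j) τ) = ∑ i, (if i = τ then
          5 * C / l * (δ⁻¹ * remainder ξ (w j) i) else 0) := by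
        rw [Finset.sum_ite_eq' Finset.univ τ, if_pos (Finset.mem_univ _)]
      rw [h6, ← Finset.sum_add_distrib]
      refine Finset.sum_congr rfl fun i _ => ?_
      simp only [hβ, Pi.smul_apply, smul_eq_mul]
      split_ifs <;> ring
    rw [h4]
    linarith

end RankDrop

section RankDropStep

variable {m n : ℕ}

theorem one_le_of_norm_latVec_le (hm : 0 < m) {ξ : Fin n → Fin m → ℝ} {δ g : ℝ} (hδ : 0 < δ)
    (hδ1 : δ ≤ 1) {v : IntPair m n} (hv : v ≠ 0) (h : ‖latVec ξ δ v‖ ≤ g * lam ξ δ) : 1 ≤ g := by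
  have h1 := (lam_le ξ δ hv).trans h
  have h2 := one_le_lam hm ξ hδ hδ1
  by_contra! h3
  nlinarith

theorem lam_le_of_integral_values (hm : 0 < m) (hn : 0 < n) {ξ ξ' : Fin n → Fin m → ℝ} {δ : ℝ}
    (hδ : 0 < δ) (hδ1 : δ ≤ 1) {r a : ℕ} {g κ : ℝ} (hr : n ≤ r) (ha : 2 ≤ a)
    (w : Fin (r + 1) → IntPair m n) (hw : LinearIndependent ℤ w)
    (hwg : ∀ j, ‖latVec ξ δ (w j)‖ ≤ g * lam ξ δ) (hξ : ξ' ∈ Metric.closedBall ξ δ) {τ : Fin n}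
    {β : Fin n → ℝ} (hβ : ∀ i, |β i| ≤ β τ) (hβτ : 0 < β τ) {k : Fin (r + 1) → ℤ}
    (hk : k 0 ≠ 0) (hkκ : ∀ j, |(k j : ℝ)| ≤ κ)
    (hΦ : ∀ j, ∑ i, β i * (δ⁻¹ * remainder ξ' (w j) i) = k j) :
    lam ξ' (δ / a ^ n) ≤ 2 * n * r * (2 * κ * (m + 1) * g) * a ^ (n - 1) * lam ξ δ := by
  classical
  set l := lam ξ δ with hl
  have hl1 : 1 ≤ l := one_le_lam hm ξ hδ hδ1
  have hg : 1 ≤ g := one_le_of_norm_latVec_le hm hδ hδ1 (hw.ne_zero 0) (hwg 0)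
  have hκ : 1 ≤ κ := by
    refine le_trans ?_ (hkκ 0)
    exact_mod_cast Int.one_le_abs hk
  have hm1 : (0 : ℝ) ≤ m := by positivity
  have hr0 : (0 : ℝ) < r := by exact_mod_cast hn.trans_le hr
  have hn0 : (1 : ℝ) ≤ n := by exact_mod_cast hn
  have ha0 : (0 : ℝ) < a := by exact_mod_cast (by omega : 0 < a)
  set U : ℝ := 2 * κ * (m + 1) * g with hU
  have hU0 : 0 < U := by positivity
  have hgl : 0 < g * l := by positivity
  set u : Fin r → IntPair m n := fun j => k 0 • w j.succ - k j.succ • w 0 with hu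
  have hw1 : ∀ j, ‖(w j).1‖ ≤ g * l := fun j => (norm_fst_le_latVec ξ hδ _).trans (hwg j)
  have hwr : ∀ j, ‖remainder ξ' (w j)‖ ≤ δ * ((m + 1) * (g * l)) := by
    intro j
    have h1 := norm_remainder_le_of_mem (Metric.mem_closedBall_comm.1 hξ) (w j)
    have h2 := (norm_remainder_le_latVec ξ hδ (w j))
    have h3 : δ * ‖latVec ξ δ (w j)‖ ≤ δ * (g * l) := by gcongr; exact hwg j
    have h4 : m * δ * ‖(w j).1‖ ≤ m * δ * (g * l) := by gcongr; exact hw1 j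
    linarith
  have hu1 : ∀ j, ‖(u j).1‖ ≤ U * l := by
    intro j
    rw [pi_norm_le_iff_of_nonneg (by positivity)]
    intro i
    simp only [hu, Prod.fst_sub, Prod.smul_fst, Pi.sub_apply, Pi.smul_apply, smul_eq_mul]
    refine (norm_sub_le _ _).trans ?_
    rw [norm_mul, norm_mul]
    have h1 : ∀ j j', ‖k j‖ * ‖(w j').1 i‖ ≤ κ * (g * l) := by
      intro j j'
      refine mul_le_mul ?_ ((norm_le_pi_norm _ i).trans (hw1 j')) (norm_nonneg _) (by positivity)
      rw [Int.norm_eq_abs]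
      exact hkκ j
    have h2 := h1 0 j.succ
    have h3 := h1 j.succ 0
    have h4 : 0 ≤ m * (κ * (g * l)) := by positivity
    rw [hU]
    linarith
  have hur : ∀ j i, |δ⁻¹ * remainder ξ' (u j) i| ≤ U * l := by
    intro j i
    rw [abs_mul, abs_of_pos (inv_pos.2 hδ), inv_mul_le_iff₀ hδ]
    simp only [hu, map_sub, map_smul, Pi.sub_apply, Pi.smul_apply]
    rw [← Int.cast_smul_eq_zsmul ℝ, ← Int.cast_smul_eq_zsmul ℝ, smul_eq_mul, smul_eq_mul]
    refine (abs_sub _ _).trans ?_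
    rw [abs_mul, abs_mul]
    have h1 : ∀ j j', |(k j : ℝ)| * |remainder ξ' (w j') i| ≤ κ * (δ * ((m + 1) * (g * l))) := by
      intro j j'
      exact mul_le_mul (hkκ j) ((norm_le_pi_norm (remainder ξ' (w j')) i).trans (hwr j'))
        (abs_nonneg _) (by positivity)
    have h2 := h1 0 j.succ
    have h3 := h1 j.succ 0
    rw [hU]
    linarith
  set A := a ^ (n - 1) with hA
  have hA0 : (0 : ℝ) < (A : ℕ) := by exact_mod_cast (by positivity : 0 < a ^ (n - 1))
  set W : ℝ := 2 * r * A * (U * l) with hW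
  have hW0 : 0 < W := by positivity
  obtain ⟨q, hq0, hqA, p, hp⟩ := dirichlet_linear_forms (ι := {i // i ≠ τ}) (κ := Fin r)
    (fun i j => δ⁻¹ * remainder ξ' (u j) i / W) (A := A) (s := a ^ n) (by positivity) (by
      rw [Fintype.card_fin, Fintype.card_subtype_compl, Fintype.card_fin, Fintype.card_unique,
        ← pow_mul, mul_comm, pow_mul, ← hA]
      calc A ^ n < (A + 1) ^ n := Nat.pow_lt_pow_left (Nat.lt_succ_self _) (by omega)
        _ ≤ (A + 1) ^ r := Nat.pow_le_pow_right (by omega) hr)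
  have hqA' : ∀ j, |(q j : ℝ)| ≤ A := by
    intro j
    exact_mod_cast hqA j
  set v := ∑ j, q j • u j with hv
  have hv0 : v ≠ 0 := by
    intro h0
    apply hq0
    have h1 : ∑ j, (Fin.cons (-∑ j, q j * k j.succ) (fun j => q j * k 0) : Fin (r + 1) → ℤ) j • w j
        = 0 := by
      rw [Fin.sum_univ_succ, Fin.cons_zero, ← h0, hv]
      simp only [Fin.cons_succ, hu, smul_sub, smul_smul, Finset.sum_sub_distrib, neg_smul,
        Finset.sum_smul]
      abel
    have h2 := Fintype.linearIndependent_iff.1 hw _ h1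
    funext j
    have h3 := h2 j.succ
    rw [Fin.cons_succ] at h3
    exact (mul_eq_zero.1 h3).resolve_right hk
  have hremv : ∀ i, δ⁻¹ * remainder ξ' v i = ∑ j, (δ⁻¹ * remainder ξ' (u j) i) * q j := by
    intro i
    rw [hv, map_sum, Finset.sum_apply, Finset.mul_sum]
    refine Finset.sum_congr rfl fun j _ => ?_
    rw [map_smul, Pi.smul_apply, ← Int.cast_smul_eq_zsmul ℝ, smul_eq_mul]
    ring
  have hs2 : (2 : ℝ) ≤ (a : ℝ) ^ n := by
    have : (2 : ℝ) ≤ a := by exact_mod_cast ha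
    exact this.trans (le_self_pow₀ (by linarith) (by omega))
  have hother : ∀ i, i ≠ τ → |δ⁻¹ * remainder ξ' v i| ≤ W / a ^ n := by
    intro i hi
    have h1 := hp ⟨i, hi⟩
    have h2 : ∑ j, δ⁻¹ * remainder ξ' (u j) i / W * q j = δ⁻¹ * remainder ξ' v i / W := by
      rw [hremv, Finset.sum_div]
      exact Finset.sum_congr rfl fun j _ => by ring
    simp only [h2] at h1
    have h3 : |δ⁻¹ * remainder ξ' v i / W| ≤ 1 / 2 := by
      rw [abs_div, abs_of_pos hW0, div_le_iff₀ hW0, hremv]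
      refine (Finset.abs_sum_le_sum_abs _ _).trans ?_
      calc _ ≤ ∑ _j : Fin r, U * l * A := by
            refine Finset.sum_le_sum fun j _ => ?_
            rw [abs_mul]
            exact mul_le_mul (hur j i) (hqA' j) (abs_nonneg _) (by positivity)
        _ = 1 / 2 * W := by
            simp only [Finset.sum_const, Finset.card_univ, Fintype.card_fin, nsmul_eq_mul, hW]
            ring
    have h4 : 1 / ((a ^ n : ℕ) : ℝ) ≤ 1 / 2 := by
      push_cast
      exact one_div_le_one_div_of_le (by norm_num) hs2
    have h5 : |(p ⟨i, hi⟩ : ℝ)| < 1 := by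
      have h6 := abs_sub_abs_le_abs_sub (p ⟨i, hi⟩ : ℝ) (δ⁻¹ * remainder ξ' v i / W)
      rw [abs_sub_comm] at h6
      linarith
    have h6 : p ⟨i, hi⟩ = 0 := Int.abs_lt_one_iff.1 (by exact_mod_cast h5)
    rw [h6, Int.cast_zero, sub_zero, abs_div, abs_of_pos hW0, div_lt_iff₀ hW0] at h1
    push_cast at h1
    calc _ ≤ _ := h1.le
      _ = _ := by ring
  have hΦu : ∀ j, ∑ i, β i * (δ⁻¹ * remainder ξ' (u j) i) = 0 := by
    intro j
    have h1 : ∑ i, β i * (δ⁻¹ * remainder ξ' (u j) i)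
        = k 0 * ∑ i, β i * (δ⁻¹ * remainder ξ' (w j.succ) i)
          - k j.succ * ∑ i, β i * (δ⁻¹ * remainder ξ' (w 0) i) := by
      rw [Finset.mul_sum, Finset.mul_sum, ← Finset.sum_sub_distrib]
      refine Finset.sum_congr rfl fun i _ => ?_
      simp only [hu, map_sub, map_smul, Pi.sub_apply, Pi.smul_apply]
      rw [← Int.cast_smul_eq_zsmul ℝ, ← Int.cast_smul_eq_zsmul ℝ, smul_eq_mul, smul_eq_mul]
      ring
    rw [h1, hΦ, hΦ]
    ring
  have hΦv : ∑ i, β i * (δ⁻¹ * remainder ξ' v i) = 0 := by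
    simp only [hremv, Finset.mul_sum]
    rw [Finset.sum_comm]
    refine Finset.sum_eq_zero fun j _ => ?_
    calc _ = q j * ∑ i, β i * (δ⁻¹ * remainder ξ' (u j) i) := by
          rw [Finset.mul_sum]
          exact Finset.sum_congr rfl fun i _ => by ring
      _ = 0 := by rw [hΦu, mul_zero]
  have hWs : 0 ≤ W / a ^ n := by positivity
  have hall : ∀ i, |δ⁻¹ * remainder ξ' v i| ≤ n * (W / a ^ n) := by
    intro i
    by_cases hi : i = τ
    · subst hi
      rw [← Finset.add_sum_erase _ _ (Finset.mem_univ i)] at hΦv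
      have h1 : β i * |δ⁻¹ * remainder ξ' v i| ≤ β i * (n * (W / a ^ n)) := by
        rw [← abs_of_pos hβτ, ← abs_mul, abs_of_pos hβτ, eq_neg_of_add_eq_zero_left hΦv, abs_neg]
        refine (Finset.abs_sum_le_sum_abs _ _).trans ?_
        calc _ ≤ ∑ _x ∈ Finset.univ.erase i, β i * (W / a ^ n) := by
              refine Finset.sum_le_sum fun x hx => ?_
              rw [abs_mul]
              exact mul_le_mul (hβ x) (hother x (Finset.ne_of_mem_erase hx)) (abs_nonneg _) hβτ.le
          _ = ((n - 1 : ℕ) : ℝ) * (β i * (W / a ^ n)) := by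
              rw [Finset.sum_const, Finset.card_erase_of_mem (Finset.mem_univ _),
                Finset.card_univ, Fintype.card_fin, nsmul_eq_mul]
          _ ≤ n * (β i * (W / a ^ n)) := by
              gcongr
              omega
          _ = _ := by ring
      exact le_of_mul_le_mul_left h1 hβτ
    · refine (hother i hi).trans ?_
      exact le_mul_of_one_le_left hWs hn0
  have hδ' : 0 < δ / a ^ n := by positivity
  refine (lam_le ξ' _ hv0).trans ((norm_latVec_le (c := n * W) hδ' ?_ ?_).trans_eq ?_)
  · rw [pi_norm_le_iff_of_nonneg (by positivity)]
    intro i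
    rw [hv, Prod.fst_sum, Finset.sum_apply]
    refine (norm_sum_le _ _).trans ?_
    calc _ ≤ ∑ _j : Fin r, A * (U * l) := by
          refine Finset.sum_le_sum fun j _ => ?_
          rw [Prod.smul_fst, Pi.smul_apply, smul_eq_mul, norm_mul, Int.norm_eq_abs]
          exact mul_le_mul (hqA' j) ((norm_le_pi_norm _ i).trans (hu1 j)) (norm_nonneg _)
            hA0.le
      _ = W / 2 := by
          simp only [Finset.sum_const, Finset.card_univ, Fintype.card_fin, nsmul_eq_mul, hW]
          ring
      _ ≤ n * W := by nlinarith
  · rw [pi_norm_le_iff_of_nonneg (by positivity)]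
    intro i
    have := hall i
    rw [abs_mul, abs_of_pos (inv_pos.2 hδ), inv_mul_le_iff₀ hδ] at this
    rw [Real.norm_eq_abs]
    refine this.trans_eq ?_
    ring
  · rw [hW, hA]
    push_cast
    ring

theorem rankLE_of_integral_values (hm : 0 < m) {ξ ξ' : Fin n → Fin m → ℝ} {δ : ℝ}
    (hδ : 0 < δ) (hδ1 : δ ≤ 1) {r s : ℕ} {g G G' M t : ℝ} (hs : 0 < s)
    (hsg : 2 * (r + 1) * g ≤ s) (w : Fin (r + 1) → IntPair m n) (hw : LinearIndependent ℤ w)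
    (hwg : ∀ j, ‖latVec ξ δ (w j)‖ ≤ g * lam ξ δ) (hξ : ξ' ∈ Metric.closedBall ξ δ) {τ : Fin n}
    {β : Fin n → ℝ} (hβ : ∀ i, |β i| ≤ β τ) (hβτ : 0 < β τ) {k : Fin (r + 1) → ℤ}
    (hk : k 0 ≠ 0) (hΦ : ∀ j, ∑ i, β i * (δ⁻¹ * remainder ξ' (w j) i) = k j)
    (hG : RankLE ξ δ (r + 1) G) (hgG : g ≤ G) (hG' : 0 ≤ G') (hM : 0 ≤ M) (ht : 1 ≤ t)
    (hlam : lam ξ' (δ / t) ≤ M * lam ξ δ) (hGG : (m + 1) * (G' * M) ≤ G)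
    (hsmall : (s : ℝ) ^ (r + 1) * (n * (β τ * lam ξ δ) * (G' * M)) < t) :
    RankLE ξ' (δ / t) r G' := by
  classical
  set l := lam ξ δ with hl
  have hl1 : 1 ≤ l := one_le_lam hm ξ hδ hδ1
  have ht0 : 0 < t := by linarith
  intro v hv
  by_contra! hshort
  set X := G' * M * l with hX
  have hX0 : 0 ≤ X := by positivity
  have hδt : 0 < δ / t := by positivity
  have hvX : ∀ j, ‖latVec ξ' (δ / t) (v j)‖ ≤ X := by
    intro j
    refine (hshort j).trans ?_
    rw [hX, mul_assoc]
    gcongr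
  have hvrem : ∀ j, ‖remainder ξ' (v j)‖ ≤ δ / t * X := by
    intro j
    refine (norm_remainder_le_latVec ξ' hδt (v j)).trans ?_
    gcongr
    exact hvX j
  have hvlat : ∀ j, ‖latVec ξ δ (v j)‖ ≤ G * l := by
    intro j
    have h1 := (norm_fst_le_latVec ξ' hδt (v j)).trans (hvX j)
    have hm1 : (0 : ℝ) ≤ m := by positivity
    have h2 : (m + 1) * X ≤ G * l := by
      calc (m + 1) * X = (m + 1) * (G' * M) * l := by rw [hX]; ring
        _ ≤ G * l := by gcongr
    refine (norm_latVec_le (c := (m + 1) * X) hδ ?_ ?_).trans h2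
    · nlinarith
    · have h3 := norm_remainder_le_of_mem hξ (v j)
      have h3' := norm_remainder_le_of_mem (Metric.mem_closedBall_comm.1 hξ) (v j)
      have h4 : δ / t * X ≤ δ * X := by
        gcongr
        exact div_le_self hδ.le ht
      have h5 : m * δ * ‖(v j).1‖ ≤ m * δ * X := by gcongr
      have h6 := hvrem j
      linarith
  have hden : ∀ j, ∃ q : ℤ, q ≠ 0 ∧ ∃ p : Fin (r + 1) → ℤ, q • v j = ∑ i, p i • w i ∧
      ∑ i, p i * k i = 0 := by
    intro j
    have hdep : ¬ LinearIndependent ℤ (Fin.cons (v j) w : Fin (r + 1 + 1) → IntPair m n) := by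
      intro h
      obtain ⟨i, hi⟩ := hG _ h
      revert hi
      refine Fin.cases ?_ (fun i => ?_) i
      · rw [Fin.cons_zero, imp_false, not_lt]
        exact hvlat j
      · rw [Fin.cons_succ, imp_false, not_lt]
        refine (hwg i).trans ?_
        gcongr
    obtain ⟨c, hc, i₀, hi₀⟩ := Fintype.not_linearIndependent_iff.1 hdep
    rw [Fin.sum_univ_succ, Fin.cons_zero] at hc
    simp only [Fin.cons_succ] at hc
    have hc0 : c 0 ≠ 0 := by
      intro h0
      rw [h0, zero_smul, zero_add] at hc
      have h1 := Fintype.linearIndependent_iff.1 hw (fun i => c i.succ) hc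
      apply hi₀
      refine Fin.cases h0 (fun i => h1 i) i₀
    obtain ⟨q, hq, hqs, p, hp⟩ := exists_denominator_of_dependent (latVec ξ δ) hs
      (zero_lt_one.trans_le hl1) (fun v hv => lam_le ξ δ hv) hwg (by simpa using hsg) (v := v j)
      hc0 (c := fun i => - c i.succ) (by
        rw [eq_neg_of_add_eq_zero_left hc, ← Finset.sum_neg_distrib]
        exact Finset.sum_congr rfl fun i _ => (neg_smul _ _).symm)
    refine ⟨q, hq, p, hp, ?_⟩
    have h1 : ((∑ i, p i * k i : ℤ) : ℝ) = q * ∑ i, β i * (δ⁻¹ * remainder ξ' (v j) i) := by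
      have h2 : ∀ i, (q : ℝ) * remainder ξ' (v j) i = ∑ i', (p i' : ℝ) * remainder ξ' (w i') i := by
        intro i
        have h3 := congrFun (congrArg (remainder ξ') hp) i
        rw [map_smul, map_sum, Finset.sum_apply, Pi.smul_apply, ← Int.cast_smul_eq_zsmul ℝ,
          smul_eq_mul] at h3
        rw [h3]
        refine Finset.sum_congr rfl fun i' _ => ?_
        rw [map_smul, Pi.smul_apply, ← Int.cast_smul_eq_zsmul ℝ, smul_eq_mul]
      push_cast
      calc ∑ i', (p i' : ℝ) * k i'
          = ∑ i', ∑ i, (p i' : ℝ) * (β i * (δ⁻¹ * remainder ξ' (w i') i)) := by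
            refine Finset.sum_congr rfl fun i' _ => ?_
            rw [← hΦ, Finset.mul_sum]
        _ = ∑ i, β i * (δ⁻¹ * ∑ i', (p i' : ℝ) * remainder ξ' (w i') i) := by
            rw [Finset.sum_comm]
            refine Finset.sum_congr rfl fun i _ => ?_
            rw [Finset.mul_sum, Finset.mul_sum]
            exact Finset.sum_congr rfl fun i' _ => by ring
        _ = _ := by
            rw [Finset.mul_sum]
            refine Finset.sum_congr rfl fun i _ => ?_
            rw [← h2]
            ring
    have h2 : |∑ i, β i * (δ⁻¹ * remainder ξ' (v j) i)| ≤ n * (β τ * (X / t)) := by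
      refine (Finset.abs_sum_le_sum_abs _ _).trans ?_
      calc _ ≤ ∑ _i : Fin n, β τ * (X / t) := by
            refine Finset.sum_le_sum fun i _ => ?_
            rw [abs_mul]
            refine mul_le_mul (hβ i) ?_ (abs_nonneg _) hβτ.le
            rw [abs_mul, abs_of_pos (inv_pos.2 hδ), inv_mul_le_iff₀ hδ]
            refine (norm_le_pi_norm (remainder ξ' (v j)) i).trans ((hvrem j).trans_eq ?_)
            ring
        _ = _ := by simp
    have h3 : |((∑ i, p i * k i : ℤ) : ℝ)| < 1 := by
      rw [h1, abs_mul]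
      have h4 : |(q : ℝ)| ≤ (s : ℝ) ^ (r + 1) := by
        rw [Fintype.card_fin] at hqs
        exact_mod_cast hqs
      calc _ ≤ (s : ℝ) ^ (r + 1) * (n * (β τ * (X / t))) := by gcongr
        _ = (s : ℝ) ^ (r + 1) * (n * (β τ * l) * (G' * M)) / t := by rw [hX]; ring
        _ < 1 := by rwa [div_lt_one ht0]
    exact Int.abs_lt_one_iff.1 (by exact_mod_cast h3)
  choose q hq p hp hpk using hden
  have hdet : (Matrix.of p).det = 0 := by
    refine Matrix.exists_mulVec_eq_zero_iff.1 ⟨k, fun h => hk (congrFun h 0), ?_⟩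
    funext j
    exact hpk j
  obtain ⟨y, hy0, hy⟩ := Matrix.exists_vecMul_eq_zero_iff.2 hdet
  have hsum : ∑ j, (y j * q j) • v j = 0 := by
    calc ∑ j, (y j * q j) • v j = ∑ j, ∑ i, (y j * p j i) • w i := by
          refine Finset.sum_congr rfl fun j _ => ?_
          rw [mul_smul, hp, Finset.smul_sum]
          simp only [smul_smul]
      _ = ∑ i, (∑ j, y j * p j i) • w i := by
          rw [Finset.sum_comm]
          simp only [Finset.sum_smul]
      _ = 0 := Finset.sum_eq_zero fun i _ => by
          have h1 : ∑ j, y j * p j i = 0 := congrFun hy i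
          rw [h1, zero_smul]
  apply hy0
  funext j
  exact (mul_eq_zero.1 (Fintype.linearIndependent_iff.1 hv _ hsum j)).resolve_right (hq j)

end RankDropStep

section RankDropTheorem

variable {m n : ℕ}

theorem Advances.mem {N k k' : ℕ} (hN : 0 < N) {ξ ξ' : Fin n → Fin m → ℝ}
    (h : Advances N k ξ k' ξ') : ξ' ∈ Metric.closedBall ξ (scale N k) :=
  h.2.1 (Metric.mem_closedBall_self (scale_pos hN k').le)

theorem scale_le_one {N : ℕ} (hN : 0 < N) (k : ℕ) : scale N k ≤ 1 := by
  have := scale_anti hN (Nat.zero_le k)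
  simpa [scale] using this

theorem exists_advances_rankLE (hm : 0 < m) (hn : 2 ≤ n) {N : ℕ} (hN : 12 * stepBound m n ≤ N)
    {r : ℕ} (hr : n ≤ r) {G' : ℝ} (hG' : 1 ≤ G') :
    ∃ (G : ℝ) (T : ℕ), ∀ k (ξ : Fin n → Fin m → ℝ), RankLE ξ (scale N k) (r + 1) G →
      ∀ w : Fin (r + 1) → IntPair m n, LinearIndependent ℤ w →
        (∀ j, ‖latVec ξ (scale N k) (w j)‖ ≤ G' * lam ξ (scale N k)) →
        ∃ ξ', Advances N k ξ (k + T) ξ' ∧ RankLE ξ' (scale N (k + T)) r G' := by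
  have hN2 : 2 ≤ N := by unfold stepBound at hN; omega
  have hN0 : 0 < N := by omega
  have hN1 : (1 : ℝ) < N := by exact_mod_cast hN2
  set s := ⌈2 * (r + 1) * G'⌉₊ + 1 with hs
  have hsg : 2 * (r + 1) * G' ≤ s := by
    rw [hs]
    push_cast
    linarith [Nat.le_ceil (2 * (r + 1) * G')]
  have hs0 : 0 < s := by omega
  have hsr : (0 : ℝ) < s := by exact_mod_cast hs0
  set C := functionalBound r s with hC
  have hC0 : 0 < C := by
    rw [hC, functionalBound]
    positivity
  set U : ℝ := 2 * (5 * C * G' + 1) * (m + 1) * G' with hU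
  have hU0 : 0 < U := by positivity
  obtain ⟨q, hq⟩ := pow_unbounded_of_one_lt
    ((s : ℝ) ^ (r + 1) * (n * (6 * C) * (G' * (2 * n * r * U)))) hN1
  set a := N ^ (q + 1) with ha
  have ha2 : 2 ≤ a := by
    rw [ha, pow_succ]
    exact hN2.trans (Nat.le_mul_of_pos_left _ (by positivity))
  have ha1 : (1 : ℝ) ≤ a := by exact_mod_cast (by omega : 1 ≤ a)
  have haD : (s : ℝ) ^ (r + 1) * (n * (6 * C) * (G' * (2 * n * r * U))) < a := by
    refine hq.trans_le ?_
    rw [ha]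
    push_cast
    exact pow_le_pow_right₀ hN1.le (Nat.le_succ q)
  set M : ℝ := 2 * n * r * U * a ^ (n - 1) with hM
  have hM0 : 0 ≤ M := by positivity
  obtain ⟨T', hT'⟩ : ∃ T', n * (q + 1) = T' + 1 :=
    ⟨n * (q + 1) - 1, by
      have : 0 < n * (q + 1) := Nat.mul_pos (by omega) (Nat.succ_pos q)
      omega⟩
  refine ⟨max G' ((m + 1) * (G' * M)), T' + 1, fun k ξ hrank w hw hwg => ?_⟩
  set δ := scale N k with hδ
  have hδ0 : 0 < δ := scale_pos hN0 k
  have hδ1 : δ ≤ 1 := scale_le_one hN0 k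
  have hne : (⟨0, by omega⟩ : Fin n) ≠ ⟨1, by omega⟩ := by simp
  obtain ⟨β, u, ζ, κ, hζ, huρ, hu, hβ, hβτ, hβl, hκ, hΦ⟩ :=
    exists_direction hm ξ hδ0 hδ1 hs0 hsg w hw hwg hne
  obtain ⟨z, hz⟩ := exists_advances_of_direction hm hN k ξ ζ hζ u huρ hu T'
  refine ⟨_, hz, ?_⟩
  have hsc : scale N (k + (T' + 1)) = δ / (a : ℝ) ^ n := by
    have h1 : scale N (n * (q + 1)) = ((a : ℝ) ^ n)⁻¹ := by
      rw [scale, mul_comm n, pow_mul, ha]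
      push_cast
      rw [inv_pow, inv_pow]
    rw [scale_add, ← hT', h1, div_eq_mul_inv]
  have hmem := hz.mem hN0
  have hΦ' := hΦ z
  rw [hsc]
  have hlam := lam_le_of_integral_values hm (by omega) hδ0 hδ1 hr ha2 w hw hwg hmem hβ hβτ
    (hκ 0).1 (fun j => (hκ j).2) hΦ'
  have ht : (1 : ℝ) ≤ (a : ℝ) ^ n := one_le_pow₀ ha1
  refine rankLE_of_integral_values hm hδ0 hδ1 hs0 hsg w hw hwg hmem hβ hβτ (hκ 0).1 hΦ' hrank
    (le_max_left _ _) (by linarith) hM0 ht hlam (le_max_right _ _) ?_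
  calc (s : ℝ) ^ (r + 1) * (n * (β _ * lam ξ δ) * (G' * M))
      ≤ (s : ℝ) ^ (r + 1) * (n * (6 * C) * (G' * M)) := by gcongr
    _ = (s : ℝ) ^ (r + 1) * (n * (6 * C) * (G' * (2 * n * r * U))) * (a : ℝ) ^ (n - 1) := by
        rw [hM]
        ring
    _ < a * (a : ℝ) ^ (n - 1) := by
        have : (0 : ℝ) < (a : ℝ) ^ (n - 1) := by positivity
        gcongr
    _ = (a : ℝ) ^ n := by rw [← pow_succ', Nat.sub_add_cancel (by omega)]

end RankDropTheorem

section Transversality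

theorem exists_submodule_finrank_eq {E : Type*} [AddCommGroup E] [Module ℝ E] {W : Submodule ℝ E}
    {d : ℕ} (hW : Module.finrank ℝ W = d + 1) : ∃ W' ≤ W, Module.finrank ℝ W' = d := by
  have : Module.Finite ℝ W := Module.finite_of_finrank_eq_succ hW
  let b := Module.finBasisOfFinrankEq ℝ W hW
  have hb : LinearIndependent ℝ fun i : Fin d => (b i.castSucc : E) :=
    (b.linearIndependent.map' W.subtype (Submodule.ker_subtype W)).comp _
      (Fin.castSucc_injective d)
  refine ⟨Submodule.span ℝ (Set.range fun i : Fin d => (b i.castSucc : E)), ?_, ?_⟩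
  · rw [Submodule.span_le]
    rintro _ ⟨i, rfl⟩
    exact (b i.castSucc).2
  · rw [finrank_span_eq_card hb, Fintype.card_fin]

variable {m n : ℕ}

/-- The map `(x, y) ↦ y + ζ x`. -/
def shear (ζ : Fin n → Fin m → ℝ) : (Fin m → ℝ) × (Fin n → ℝ) →ₗ[ℝ] (Fin n → ℝ) where
  toFun v i := v.2 i + ∑ j, ζ i j * v.1 j
  map_add' v w := by
    funext i
    simp only [Prod.fst_add, Prod.snd_add, Pi.add_apply, mul_add, Finset.sum_add_distrib]
    ring
  map_smul' c v := by
    funext i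
    simp only [Prod.smul_fst, Prod.smul_snd, Pi.smul_apply, smul_eq_mul, RingHom.id_apply, mul_add,
      Finset.mul_sum]
    congr 1
    exact Finset.sum_congr rfl fun j _ => by ring

theorem shear_apply (ζ : Fin n → Fin m → ℝ) (v : (Fin m → ℝ) × (Fin n → ℝ)) (i : Fin n) :
    shear ζ v i = v.2 i + ∑ j, ζ i j * v.1 j := rfl

theorem norm_snd_le_shear {ζ : Fin n → Fin m → ℝ} {τ : ℝ} (hζ : ‖ζ‖ ≤ τ)
    (v : (Fin m → ℝ) × (Fin n → ℝ)) : ‖v.2‖ ≤ ‖shear ζ v‖ + m * τ * ‖v.1‖ := by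
  have hτ := (norm_nonneg ζ).trans hζ
  refine (pi_norm_le_iff_of_nonneg (by positivity)).2 fun i => ?_
  have h1 : v.2 i = shear ζ v i - ∑ j, ζ i j * v.1 j := by
    rw [shear_apply]
    ring
  have h2 : ‖∑ j, ζ i j * v.1 j‖ ≤ m * τ * ‖v.1‖ := by
    refine (norm_sum_le _ _).trans ?_
    calc _ ≤ ∑ _j : Fin m, τ * ‖v.1‖ := by
          refine Finset.sum_le_sum fun j _ => ?_
          rw [norm_mul]
          exact mul_le_mul ((abs_entry_le_norm ζ i j).trans hζ) (norm_le_pi_norm v.1 j)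
            (norm_nonneg _) hτ
      _ = _ := by
          rw [Finset.sum_const, Finset.card_univ, Fintype.card_fin, nsmul_eq_mul, mul_assoc]
  rw [h1]
  exact (norm_sub_le _ _).trans (by gcongr; exact norm_le_pi_norm _ i)

/-- A subspace of dimension at most `n` is uniformly transversal to the kernel of some small
shear. -/
theorem exists_shear_bound {τ : ℝ} (hτ : 0 < τ) (d : ℕ) (hd : d ≤ n) :
    ∃ c : ℝ, 1 ≤ c ∧ ∀ W : Submodule ℝ ((Fin m → ℝ) × (Fin n → ℝ)), Module.finrank ℝ W = d →
      ∃ ζ : Fin n → Fin m → ℝ, ‖ζ‖ ≤ τ ∧ ∀ v ∈ W, ‖v‖ ≤ c * ‖shear ζ v‖ := by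
  induction d generalizing τ with
  | zero =>
    refine ⟨1, le_rfl, fun W hW => ⟨0, by simpa using hτ.le, fun v hv => ?_⟩⟩
    rw [Submodule.finrank_eq_zero] at hW
    rw [hW, Submodule.mem_bot] at hv
    simp [hv]
  | succ d ih =>
    obtain ⟨c, hc1, hc⟩ := ih (half_pos hτ) (by omega)
    have hc0 : 0 < c := by linarith
    set h : ℝ := (2 * (1 + m * τ))⁻¹ with hh
    have hh0 : 0 < h := by positivity
    set B : ℝ := 4 / τ + 3 * c with hB
    have hB0 : 0 < B := by positivity
    set σ : ℝ := min (1 / 2) (min (1 / (2 * c)) (h / (2 * B))) with hσ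
    have hσ0 : 0 < σ := by positivity
    have hσ1 : σ ≤ 1 / 2 := min_le_left _ _
    have hσ2 : σ ≤ 1 / (2 * c) := (min_le_right _ _).trans (min_le_left _ _)
    have hσ3 : σ ≤ h / (2 * B) := (min_le_right _ _).trans (min_le_right _ _)
    rw [le_div_iff₀ (by positivity)] at hσ2 hσ3
    refine ⟨max (1 / σ) (3 * c + 6 * B / h), ?_, fun W hW => ?_⟩
    · refine le_max_of_le_left ?_
      rw [le_div_iff₀ hσ0]
      linarith
    obtain ⟨W', hW'W, hW'⟩ := exists_submodule_finrank_eq hW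
    obtain ⟨ζ', hζ', hW'c⟩ := hc W' hW'
    by_cases hcase : ∀ v ∈ W, σ * ‖v‖ ≤ ‖shear ζ' v‖
    · refine ⟨ζ', hζ'.trans (by linarith), fun v hv => ?_⟩
      calc ‖v‖ ≤ 1 / σ * ‖shear ζ' v‖ := by
            rw [div_mul_eq_mul_div, one_mul, le_div_iff₀ hσ0, mul_comm]
            exact hcase v hv
        _ ≤ _ := by gcongr; exact le_max_left _ _
    push Not at hcase
    obtain ⟨p₀, hp₀W, hp₀⟩ := hcase
    have hp₀0 : p₀ ≠ 0 := by
      rintro rfl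
      simp at hp₀
    obtain ⟨p, hpW, hp1, hpσ⟩ : ∃ p ∈ W, ‖p‖ = 1 ∧ ‖shear ζ' p‖ < σ := by
      have h0 : 0 < ‖p₀‖ := norm_pos_iff.2 hp₀0
      refine ⟨‖p₀‖⁻¹ • p₀, W.smul_mem _ hp₀W, ?_, ?_⟩
      · rw [norm_smul, norm_inv, norm_norm, inv_mul_cancel₀ h0.ne']
      · rw [map_smul, norm_smul, norm_inv, norm_norm, inv_mul_lt_iff₀ h0, mul_comm]
        exact hp₀
    have hpW' : p ∉ W' := by
      intro hp
      have h1 := hW'c p hp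
      rw [hp1] at h1
      have h2 : c * ‖shear ζ' p‖ < c * σ := by gcongr
      linarith
    have hsup : W' ⊔ Submodule.span ℝ {p} = W := by
      have hle : W' ⊔ Submodule.span ℝ {p} ≤ W :=
        sup_le hW'W ((Submodule.span_singleton_le_iff_mem _ _).2 hpW)
      have hlt : W' < W' ⊔ Submodule.span ℝ {p} := by
        refine lt_of_le_of_ne le_sup_left fun h => hpW' ?_
        rw [h]
        exact Submodule.mem_sup_right (Submodule.mem_span_singleton_self p)
      have := Submodule.finrank_lt_finrank_of_lt hlt
      exact Submodule.eq_of_le_of_finrank_le hle (by omega)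
    obtain ⟨j₀, hj₀⟩ : ∃ j₀, h ≤ |p.1 j₀| := by
      by_contra! hcon
      have h1 : ‖p.1‖ ≤ h := (pi_norm_le_iff_of_nonneg hh0.le).2 fun j => (hcon j).le
      have h2 := norm_snd_le_shear hζ' p
      have h3 : m * (τ / 2) * ‖p.1‖ ≤ m * (τ / 2) * h := by gcongr
      have h4 : 2 * (1 + m * τ) * h = 1 := mul_inv_cancel₀ (by positivity)
      have h5 : (0 : ℝ) ≤ m * τ * h := by positivity
      have h6 : ‖p‖ = max ‖p.1‖ ‖p.2‖ := rfl
      rw [hp1] at h6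
      rcases le_total ‖p.1‖ ‖p.2‖ with h7 | h7
      · rw [max_eq_right h7] at h6
        nlinarith
      · rw [max_eq_left h7] at h6
        nlinarith
    have hF : ∃ y, y ∉ W'.map (shear ζ') := by
      by_contra! hcon
      have h1 : W'.map (shear ζ') = ⊤ := (Submodule.eq_top_iff'.2 hcon)
      have h2 := Submodule.finrank_map_le (shear ζ') W'
      rw [h1, finrank_top, Module.finrank_fin_fun] at h2
      omega
    obtain ⟨y, -, hy1, hy⟩ := riesz_lemma_of_lt_one (𝕜 := ℝ)
      (Submodule.closed_of_finiteDimensional (W'.map (shear ζ'))) hF (r := 1 / 2) (by norm_num)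
    have hy' : ∀ w ∈ W', ∀ s : ℝ, |s| / 2 ≤ ‖shear ζ' w + s • y‖ := by
      intro w hw s
      by_cases hs : s = 0
      · simp [hs]
      have h1 := hy _ (Submodule.mem_map_of_mem (W'.smul_mem (-s⁻¹) hw))
      have h2 : shear ζ' w + s • y = s • (y - shear ζ' (-s⁻¹ • w)) := by
        rw [map_smul, smul_sub, smul_smul, mul_neg, mul_inv_cancel₀ hs, neg_smul, one_smul]
        abel
      rw [h2, norm_smul, Real.norm_eq_abs]
      have := abs_nonneg s
      nlinarith
    refine ⟨ζ' + fun i j => if j = j₀ then τ / 2 * y i else 0, ?_, fun v hv => ?_⟩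
    · refine (norm_add_le _ _).trans ?_
      have : ‖(fun i j => if j = j₀ then τ / 2 * y i else 0 : Fin n → Fin m → ℝ)‖ ≤ τ / 2 := by
        refine matrix_norm_le (by positivity) fun i j => ?_
        split_ifs
        · rw [abs_mul, abs_of_pos (half_pos hτ)]
          have h1 : |y i| ≤ 1 := (norm_le_pi_norm y i).trans hy1.le
          nlinarith
        · rw [abs_zero]
          positivity
      linarith
    have hshear : shear (ζ' + fun i j => if j = j₀ then τ / 2 * y i else 0) v
        = shear ζ' v + (τ / 2 * v.1 j₀) • y := by
      funext i
      simp only [shear_apply, Pi.add_apply, Pi.smul_apply, smul_eq_mul, add_mul,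
        Finset.sum_add_distrib, ite_mul, zero_mul, Finset.sum_ite_eq', Finset.mem_univ, if_true]
      ring
    rw [← hsup] at hv
    obtain ⟨w, hw, q, hq, rfl⟩ := Submodule.mem_sup.1 hv
    obtain ⟨a, rfl⟩ := Submodule.mem_span_singleton.1 hq
    set v := w + a • p with hvdef
    set κ := ‖shear (ζ' + fun i j => if j = j₀ then τ / 2 * y i else 0) v‖ with hκ
    have hκ0 : 0 ≤ κ := norm_nonneg _
    have ha0 := abs_nonneg a
    have hap : ‖a • shear ζ' p‖ ≤ |a| * σ := by
      rw [norm_smul, Real.norm_eq_abs]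
      gcongr
    have h1 : ‖shear ζ' w + (τ / 2 * v.1 j₀) • y‖ ≤ κ + |a| * σ := by
      have e : shear ζ' w + (τ / 2 * v.1 j₀) • y
          = shear (ζ' + fun i j => if j = j₀ then τ / 2 * y i else 0) v - a • shear ζ' p := by
        rw [hshear, hvdef, map_add, map_smul]
        abel
      rw [e]
      exact (norm_sub_le _ _).trans (by gcongr)
    have h2 := (hy' w hw (τ / 2 * v.1 j₀)).trans h1
    rw [abs_mul, abs_of_pos (half_pos hτ)] at h2
    have h3 : ‖w‖ ≤ 3 * c * (κ + |a| * σ) := by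
      have h4 : ‖shear ζ' w‖ ≤ 3 * (κ + |a| * σ) := by
        have h5 : ‖(τ / 2 * v.1 j₀) • y‖ ≤ 2 * (κ + |a| * σ) := by
          rw [norm_smul, hy1, mul_one, Real.norm_eq_abs, abs_mul, abs_of_pos (half_pos hτ)]
          linarith
        have h6 := norm_sub_le (shear ζ' w + (τ / 2 * v.1 j₀) • y) ((τ / 2 * v.1 j₀) • y)
        rw [add_sub_cancel_right] at h6
        linarith
      calc ‖w‖ ≤ c * ‖shear ζ' w‖ := hW'c w hw
        _ ≤ c * (3 * (κ + |a| * σ)) := by gcongr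
        _ = _ := by ring
    have h4 : |a| * h ≤ B * (κ + |a| * σ) := by
      have h5 : a * p.1 j₀ = v.1 j₀ - w.1 j₀ := by
        simp [hvdef]
      have h6 : |w.1 j₀| ≤ ‖w‖ := (norm_le_pi_norm w.1 j₀).trans (norm_fst_le w)
      have h7 : |v.1 j₀| ≤ 4 / τ * (κ + |a| * σ) := by
        rw [div_mul_eq_mul_div, le_div_iff₀ hτ]
        linarith
      calc |a| * h ≤ |a| * |p.1 j₀| := by gcongr
        _ = |v.1 j₀ - w.1 j₀| := by rw [← abs_mul, h5]
        _ ≤ |v.1 j₀| + |w.1 j₀| := abs_sub _ _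
        _ ≤ _ := by
            rw [hB, add_mul]
            linarith
    have h5 : |a| ≤ 2 * B / h * κ := by
      have h6 : |a| * (σ * (2 * B)) ≤ |a| * h := by gcongr
      rw [div_mul_eq_mul_div, le_div_iff₀ hh0]
      nlinarith
    have h6 : ‖v‖ ≤ ‖w‖ + |a| := by
      refine (norm_add_le _ _).trans ?_
      rw [norm_smul, hp1, mul_one, Real.norm_eq_abs]
    have h7 : |a| * (σ * (2 * c)) ≤ |a| * 1 := by gcongr
    calc ‖v‖ ≤ (3 * c + 6 * B / h) * κ := by
          have : 6 * B / h * κ = 3 * (2 * B / h * κ) := by ring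
          rw [add_mul, this]
          nlinarith
      _ ≤ _ := by gcongr; exact le_max_right _ _

end Transversality

section Jumps

variable {m n : ℕ}

/-- Every subspace of dimension at most `n` is transversal, with constant `c`, to the kernel of a
small shear. -/
def Transversal (m n : ℕ) (c : ℝ) : Prop :=
  ∀ W : Submodule ℝ ((Fin m → ℝ) × (Fin n → ℝ)), Module.finrank ℝ W ≤ n →
    ∃ ζ : Fin n → Fin m → ℝ, ‖ζ‖ ≤ 1 / 4 ∧ ∀ v ∈ W, ‖v‖ ≤ c * ‖shear ζ v‖

theorem exists_transversal (m n : ℕ) : ∃ c, 1 ≤ c ∧ Transversal m n c := by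
  have h := fun d : Fin (n + 1) => exists_shear_bound (m := m) (n := n) (τ := 1 / 4)
    (by norm_num) d (Nat.lt_succ_iff.1 d.2)
  choose c hc1 hc using h
  have hle : ∀ d, c d ≤ ∑ d, c d := fun d =>
    Finset.single_le_sum (fun d _ => zero_le_one.trans (hc1 d)) (Finset.mem_univ d)
  refine ⟨∑ d, c d, (hc1 0).trans (hle 0), fun W hW => ?_⟩
  obtain ⟨ζ, hζ, h⟩ := hc ⟨_, Nat.lt_succ_iff.2 hW⟩ W rfl
  exact ⟨ζ, hζ, fun v hv => (h v hv).trans (by gcongr; exact hle _)⟩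

/-- There is a vector with small remainder, not improved by any vector which is up to `K` times
longer. -/
def Jump (K : ℝ) (η : Fin n → Fin m → ℝ) : Prop :=
  ∃ R l : ℝ, (∃ v : IntPair m n, v.1 ≠ 0 ∧ ‖v.1‖ ≤ R ∧ ‖remainder η v‖ ≤ l) ∧
    ∀ v : IntPair m n, R < ‖v.1‖ → ‖v.1‖ < K * R → l < ‖remainder η v‖

theorem exists_norm_latVec_le_two_mul_lam (hm : 0 < m) (ξ : Fin n → Fin m → ℝ) {δ : ℝ}
    (hδ : 0 < δ) (hδ1 : δ ≤ 1) : ∃ v, v.1 ≠ 0 ∧ ‖latVec ξ δ v‖ ≤ 2 * lam ξ δ := by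
  have hl := one_le_lam hm ξ hδ hδ1
  obtain ⟨v, hv, hvl⟩ := exists_norm_latVec_lt hm (show lam ξ δ < 2 * lam ξ δ by linarith)
  by_cases h : v.1 = 0
  · obtain ⟨x, hx, hx1⟩ := exists_norm_eq_one hm
    obtain ⟨y, hy⟩ := exists_norm_remainder_le_half ξ x
    refine ⟨(x, y), hx, norm_latVec_le hδ (by rw [hx1]; linarith) ?_⟩
    have h1 := one_le_norm_remainder_of_fst_eq_zero ξ hv h
    have h2 := norm_remainder_le_latVec ξ hδ v
    have h3 : δ * ‖latVec ξ δ v‖ ≤ δ * (2 * lam ξ δ) := by gcongr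
    linarith
  · exact ⟨v, h, hvl.le⟩

theorem finrank_span_le_of_rankLE {ξ : Fin n → Fin m → ℝ} {δ G : ℝ} {r : ℕ}
    (h : RankLE ξ δ r G) :
    Module.finrank ℝ (Submodule.span ℝ (latVec ξ δ '' {v | ‖latVec ξ δ v‖ ≤ G * lam ξ δ})) ≤ r := by
  by_contra! hcon
  obtain ⟨f, hf, -, hfi⟩ := Submodule.exists_fun_fin_finrank_span_eq ℝ
    (latVec ξ δ '' {v | ‖latVec ξ δ v‖ ≤ G * lam ξ δ})
  choose w hw hwf using hf
  have hw' : LinearIndependent ℤ w := by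
    refine LinearIndependent.of_comp (latVec ξ δ) ?_
    have : latVec ξ δ ∘ w = f := funext hwf
    rw [this]
    exact hfi.restrict_scalars' ℤ
  obtain ⟨j, hj⟩ := h (w ∘ Fin.castLE hcon) (hw'.comp _ (Fin.castLE_injective hcon))
  exact absurd (hw (Fin.castLE hcon j)) (not_le.2 hj)

theorem exists_advances_jump_of_rankLE (hm : 0 < m) (hn : 0 < n) {N : ℕ}
    (hN : 12 * stepBound m n ≤ N) {c : ℝ} (hc1 : 1 ≤ c) (hc : Transversal m n c)
    (hNc : 2 * m * c * (3 * stepBound m n + 1) ≤ N) {K : ℝ} (hK : 0 ≤ K) :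
    ∃ G : ℝ, ∀ k (ξ : Fin n → Fin m → ℝ), RankLE ξ (scale N k) n G →
      ∃ ξ', Advances N k ξ (k + 1) ξ' ∧
        ∀ η ∈ Metric.closedBall ξ' (scale N (k + 1)), Jump K η := by
  have hN0 : 0 < N := by unfold stepBound at hN; omega
  have hNr : (0 : ℝ) < N := by exact_mod_cast hN0
  refine ⟨(1 + m) * (K * (4 * c * (1 + m))) + 2 * (1 + m), fun k ξ hrank => ?_⟩
  set G : ℝ := (1 + m) * (K * (4 * c * (1 + m))) + 2 * (1 + m) with hG
  set δ := scale N k with hδ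
  set ε := scale N (k + 1) with hε
  have hδ0 : 0 < δ := scale_pos hN0 k
  have hδ1 : δ ≤ 1 := scale_le_one hN0 k
  have hεδ : ε * N = δ := by
    rw [hε, scale_succ]
    field_simp
    rfl
  have hlam := one_le_lam hm ξ hδ0 hδ1
  set l := lam ξ δ with hl
  obtain ⟨ζ, hζ, hW⟩ := hc _ (finrank_span_le_of_rankLE hrank)
  obtain ⟨x, hx, -⟩ := exists_norm_eq_one hm
  obtain ⟨z, hz, hadv, -⟩ := exists_advances_succ_of_direction hm hN k ξ (δ • ζ) (by
    rw [norm_smul, Real.norm_eq_abs, abs_of_pos hδ0]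
    nlinarith) (fun _ => 1) (ρ := ⟨0, hn⟩) rfl (by simp) ((x, 0) : IntPair m n) hx
  refine ⟨_, hadv, fun η hη => ?_⟩
  have hηξ : η ∈ Metric.closedBall ξ δ := hadv.2.1 hη
  have hηξ' : ξ ∈ Metric.closedBall η δ := by
    rw [Metric.mem_closedBall, dist_comm]
    exact hηξ
  have hηζ : ‖ξ + δ • ζ - η‖ ≤ (3 * stepBound m n + 1) * ε := by
    rw [Metric.mem_closedBall, dist_comm, dist_eq_norm] at hη
    have e : ξ + δ • ζ - η = (ξ + δ • ζ + (fun i j => (fun _ => (1 : ℝ)) i * z j) - η)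
        - fun i j => (fun _ => (1 : ℝ)) i * z j := by abel
    rw [e]
    refine (norm_sub_le _ _).trans ?_
    have : ‖(fun i j => (fun _ => (1 : ℝ)) i * z j : Fin n → Fin m → ℝ)‖
        ≤ 3 * stepBound m n * ε := by
      refine matrix_norm_le (by have := scale_pos hN0 (k + 1); positivity) fun i j => ?_
      rw [one_mul]
      exact hz j
    linarith
  obtain ⟨v₀, hv₀, hv₀l⟩ := exists_norm_latVec_le_two_mul_lam hm ξ hδ0 hδ1
  refine ⟨4 * c * (1 + m) * l, 2 * (1 + m) * δ * l, ⟨v₀, hv₀, ?_, ?_⟩, fun v hv1 hv2 => ?_⟩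
  · have h1 := (norm_fst_le_latVec ξ hδ0 v₀).trans hv₀l
    have h2 : 1 * 1 ≤ c * (1 + m) := mul_le_mul hc1 (by simp) (by norm_num) (by linarith)
    nlinarith
  · have h1 := norm_remainder_le_of_mem hηξ' v₀
    have h2 := norm_remainder_le_latVec ξ hδ0 v₀
    have h3 := norm_fst_le_latVec ξ hδ0 v₀
    have h4 : δ * ‖latVec ξ δ v₀‖ ≤ δ * (2 * l) := by gcongr
    have h5 : m * δ * ‖v₀.1‖ ≤ m * δ * (2 * l) := by
      gcongr
      exact h3.trans hv₀l
    nlinarith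
  · by_cases hvS : ‖latVec ξ δ v‖ ≤ G * l
    · have h1 := hW _ (Submodule.subset_span ⟨v, hvS, rfl⟩)
      have h2 : shear ζ (latVec ξ δ v) = δ⁻¹ • remainder (ξ + δ • ζ) v := by
        funext i
        rw [shear_apply, latVec_apply]
        simp only [Pi.smul_apply, remainder_add_apply, smul_eq_mul, mul_add, Finset.mul_sum]
        congr 1
        refine Finset.sum_congr rfl fun j _ => ?_
        field_simp
      rw [h2, norm_smul, norm_inv, Real.norm_eq_abs, abs_of_pos hδ0] at h1
      have h3 := norm_remainder_sub_le (ξ + δ • ζ) η v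
      have h4 : m * ‖ξ + δ • ζ - η‖ * ‖v.1‖ ≤ m * ((3 * stepBound m n + 1) * ε) * ‖v.1‖ := by
        gcongr
      have h5 : 2 * c * (m * ((3 * stepBound m n + 1) * ε)) ≤ δ := by
        have hε0 : 0 < ε := scale_pos hN0 (k + 1)
        rw [← hεδ]
        nlinarith
      have h6 : 2 * c * (m * ((3 * stepBound m n + 1) * ε)) * ‖v.1‖ ≤ δ * ‖v.1‖ := by gcongr
      have h7 := norm_sub_norm_le (remainder (ξ + δ • ζ) v) (remainder η v)
      have h8 := norm_fst_le_latVec ξ hδ0 v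
      have h9 : δ * ‖latVec ξ δ v‖ ≤ c * ‖remainder (ξ + δ • ζ) v‖ := by
        calc δ * ‖latVec ξ δ v‖ ≤ δ * (c * (δ⁻¹ * ‖remainder (ξ + δ • ζ) v‖)) := by gcongr
          _ = _ := by field_simp
      have h10 : δ * ‖v.1‖ ≤ δ * ‖latVec ξ δ v‖ := by gcongr
      have h11 : δ * (4 * c * (1 + m) * l) < δ * ‖v.1‖ := by gcongr
      have h12 : c * ‖remainder (ξ + δ • ζ) v‖
          ≤ c * (‖remainder η v‖ + m * ((3 * stepBound m n + 1) * ε) * ‖v.1‖) := by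
        gcongr
        linarith
      have h13 : c * (2 * (1 + m) * δ * l) < c * ‖remainder η v‖ := by linarith
      exact lt_of_mul_lt_mul_left h13 (by linarith)
    · push Not at hvS
      have hKl : K * (4 * c * (1 + m) * l) ≤ G * l := by
        have h1 : (0 : ℝ) ≤ K * (4 * c * (1 + m)) := by positivity
        have h2 : (0 : ℝ) ≤ m * (K * (4 * c * (1 + m))) := by positivity
        have h3 : (0 : ℝ) ≤ m := by positivity
        rw [hG]
        nlinarith
      have h1 : δ * (G * l) < ‖remainder ξ v‖ := by
        by_contra! h
        exact hvS.not_ge (norm_latVec_le hδ0 (hv2.le.trans hKl) h)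
      have h2 := norm_remainder_le_of_mem hηξ v
      have h3 : m * δ * ‖v.1‖ ≤ m * δ * (K * (4 * c * (1 + m) * l)) := by gcongr
      have h4 : 0 ≤ δ * (K * (4 * c * (1 + m))) * l := by positivity
      have h5 : δ * (G * l) = m * δ * (K * (4 * c * (1 + m) * l))
          + δ * (K * (4 * c * (1 + m))) * l + 2 * (1 + m) * δ * l := by
        rw [hG]
        ring
      linarith

end Jumps

section ForcedJumps

variable {m n : ℕ}

theorem rankLE_top (ξ : Fin n → Fin m → ℝ) (δ G : ℝ) : RankLE ξ δ (n + m) G := by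
  intro w hw
  have := hw.fintype_card_le_finrank
  rw [Module.finrank_prod, Module.finrank_fin_fun, Module.finrank_fin_fun, Fintype.card_fin] at this
  omega

theorem RankLE.mono (hm : 0 < m) {ξ : Fin n → Fin m → ℝ} {δ G G' : ℝ} {r : ℕ} (hδ : 0 < δ)
    (hδ1 : δ ≤ 1) (hG : G ≤ G') (h : RankLE ξ δ r G') : RankLE ξ δ r G := by
  intro w hw
  obtain ⟨j, hj⟩ := h w hw
  have := one_le_lam hm ξ hδ hδ1
  exact ⟨j, lt_of_le_of_lt (by gcongr) hj⟩

theorem exists_advances_jump_add (hm : 0 < m) (hn : 2 ≤ n) {N : ℕ}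
    (hN : 12 * stepBound m n ≤ N) {c : ℝ} (hc1 : 1 ≤ c) (hc : Transversal m n c)
    (hNc : 2 * m * c * (3 * stepBound m n + 1) ≤ N) {K : ℝ} (hK : 0 ≤ K) (d : ℕ) :
    ∃ (G : ℝ) (T : ℕ), ∀ k (ξ : Fin n → Fin m → ℝ), RankLE ξ (scale N k) (n + d) G →
      ∃ ξ', Advances N k ξ (k + T) ξ' ∧
        ∀ η ∈ Metric.closedBall ξ' (scale N (k + T)), Jump K η := by
  have hN0 : 0 < N := by unfold stepBound at hN; omega
  induction d with
  | zero =>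
    obtain ⟨G, h⟩ := exists_advances_jump_of_rankLE hm (by omega) hN hc1 hc hNc hK
    exact ⟨G, 1, h⟩
  | succ d ih =>
    obtain ⟨G', T', h⟩ := ih
    obtain ⟨G, T, h'⟩ := exists_advances_rankLE hm hn hN (Nat.le_add_right n d)
      (le_max_right G' 1)
    refine ⟨G, T + T', fun k ξ hrank => ?_⟩
    by_cases hr : RankLE ξ (scale N k) (n + d) (max G' 1)
    · obtain ⟨ξ', hξ', hJ⟩ := h k ξ (hr.mono hm (scale_pos hN0 k) (scale_le_one hN0 k)
        (le_max_left _ _))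
      obtain ⟨ξ'', hξ''⟩ := exists_advances hm (by omega) hN (k + T') ξ' T
      rw [add_comm T, ← add_assoc]
      exact ⟨ξ'', hξ'.trans hξ'', fun η hη => hJ η (hξ''.2.1 hη)⟩
    · unfold RankLE at hr
      push Not at hr
      obtain ⟨w, hw, hwg⟩ := hr
      obtain ⟨ξ', hξ', hrank'⟩ := h' k ξ hrank w hw hwg
      obtain ⟨ξ'', hξ'', hJ⟩ := h (k + T) ξ' (hrank'.mono hm (scale_pos hN0 _)
        (scale_le_one hN0 _) (le_max_left _ _))
      rw [← add_assoc]
      exact ⟨ξ'', hξ'.trans hξ'', hJ⟩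

theorem exists_advances_jump (hm : 0 < m) (hn : 2 ≤ n) {N : ℕ}
    (hN : 12 * stepBound m n ≤ N) {c : ℝ} (hc1 : 1 ≤ c) (hc : Transversal m n c)
    (hNc : 2 * m * c * (3 * stepBound m n + 1) ≤ N) {K : ℝ} (hK : 0 ≤ K) {v : IntPair m n}
    (hv : v.1 ≠ 0) :
    ∃ T : ℕ, ∀ k (ξ : Fin n → Fin m → ℝ), ∃ ξ', Advances N k ξ (k + T) ξ' ∧
        ∀ η ∈ Metric.closedBall ξ' (scale N (k + T)), Jump K η ∧ 0 < ‖remainder η v‖ := by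
  have hN0 : 0 < N := by unfold stepBound at hN; omega
  obtain ⟨G, T, h⟩ := exists_advances_jump_add hm hn hN hc1 hc hNc hK m
  refine ⟨T + 1, fun k ξ => ?_⟩
  obtain ⟨ξ', hξ', hJ⟩ := h k ξ (rankLE_top _ _ _)
  obtain ⟨z, -, hz, hpos⟩ := exists_advances_succ_of_direction hm hN (k + T) ξ' 0
    (by rw [norm_zero]; have := scale_pos hN0 (k + T); positivity) (fun _ => 1)
    (ρ := ⟨0, by omega⟩) rfl (by simp) v hv
  exact ⟨_, hξ'.trans hz, fun η hη => ⟨hJ η (hz.2.1 hη), hpos η hη⟩⟩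

end ForcedJumps

section BestApproximations

variable {m n : ℕ}

theorem exists_natCast_eq_norm (x : Fin m → ℤ) : ∃ k : ℕ, ‖x‖ = k := by
  rcases Nat.eq_zero_or_pos m with rfl | hm
  · exact ⟨0, by simp [Subsingleton.elim x 0]⟩
  · obtain ⟨j, hj⟩ := exists_abs_eq_norm x hm
    exact ⟨(x j).natAbs, by rw [← hj, Nat.cast_natAbs, Int.cast_abs]⟩

theorem norm_snd_le_remainder (A : Fin n → Fin m → ℝ) (v : IntPair m n) :
    ‖v.2‖ ≤ ‖remainder A v‖ + m * ‖A‖ * ‖v.1‖ := by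
  refine (pi_norm_le_iff_of_nonneg (by positivity)).2 fun i => ?_
  have h1 : (v.2 i : ℝ) = ∑ j, A i j * v.1 j - remainder A v i := by
    rw [remainder_apply]
    ring
  have h2 := abs_sum_mul_le v.1 (fun j => abs_entry_le_norm A i j)
  have h3 := norm_le_pi_norm (remainder A v) i
  rw [Real.norm_eq_abs] at h3
  rw [Int.norm_eq_abs, h1]
  have := abs_sub (∑ j, A i j * v.1 j) (remainder A v i)
  linarith

theorem finite_small_remainder (A : Fin n → Fin m → ℝ) (R l : ℝ) :
    {v : IntPair m n | ‖v.1‖ ≤ R ∧ ‖remainder A v‖ ≤ l}.Finite := by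
  refine ((isCompact_closedBall (0 : IntPair m n)
    (max R (l + m * ‖A‖ * R))).finite_of_discrete).subset fun v hv => ?_
  rw [mem_closedBall_zero_iff, Prod.norm_def]
  refine max_le_max hv.1 ((norm_snd_le_remainder A v).trans (add_le_add hv.2 ?_))
  have := hv.1
  gcongr

/-- No vector that is not longer has a smaller remainder. -/
def IsMinimalPoint (A : Fin n → Fin m → ℝ) (v : IntPair m n) : Prop :=
  v.1 ≠ 0 ∧ ∀ u : IntPair m n, u.1 ≠ 0 → ‖u.1‖ ≤ ‖v.1‖ → ‖remainder A v‖ ≤ ‖remainder A u‖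

theorem exists_min_remainder (hm : 0 < m) (A : Fin n → Fin m → ℝ) {R : ℝ} (hR : 1 ≤ R) :
    ∃ v : IntPair m n, v.1 ≠ 0 ∧ ‖v.1‖ ≤ R ∧
      ∀ u : IntPair m n, u.1 ≠ 0 → ‖u.1‖ ≤ R → ‖remainder A v‖ ≤ ‖remainder A u‖ := by
  obtain ⟨x, hx, hx1⟩ := exists_norm_eq_one hm
  obtain ⟨y, hy⟩ := exists_norm_remainder_le_half A x
  set S := {v : IntPair m n | v.1 ≠ 0 ∧ ‖v.1‖ ≤ R ∧ ‖remainder A v‖ ≤ 1 / 2} with hS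
  have hfin : S.Finite := (finite_small_remainder A R (1 / 2)).subset fun v hv => hv.2
  obtain ⟨v, hv, hmin⟩ := hfin.exists_minimalFor (fun v => ‖remainder A v‖) S
    ⟨(x, y), hx, by rw [hx1]; exact hR, hy⟩
  refine ⟨v, hv.1, hv.2.1, fun u hu huR => ?_⟩
  by_contra! h
  exact h.not_ge (hmin ⟨hu, huR, h.le.trans hv.2.2⟩ h.le)

theorem exists_remainder_lt (A : Fin n → Fin m → ℝ) (hm : 0 < m) {l : ℝ} (hl : 0 < l) :
    ∃ u : IntPair m n, u.1 ≠ 0 ∧ ‖remainder A u‖ < l := by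
  obtain ⟨s, hs⟩ := exists_nat_one_div_lt hl
  obtain ⟨q, hq, -, p, hp⟩ := dirichlet_linear_forms A (A := (s + 1) ^ n) (s := s + 1)
    (Nat.succ_pos s) (by
      rw [Fintype.card_fin, Fintype.card_fin]
      exact (Nat.lt_succ_self _).trans_le (Nat.le_self_pow hm.ne' _))
  refine ⟨(q, p), hq, (pi_norm_lt_iff hl).2 fun i => ?_⟩
  rw [Real.norm_eq_abs, remainder_apply]
  have := hp i
  push_cast at this
  exact this.trans hs

theorem exists_next_minimalPoint (hm : 0 < m) {A : Fin n → Fin m → ℝ}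
    (hA : ∀ v : IntPair m n, v.1 ≠ 0 → 0 < ‖remainder A v‖) {v : IntPair m n}
    (hv : IsMinimalPoint A v) :
    ∃ v', IsMinimalPoint A v' ∧ ‖v.1‖ < ‖v'.1‖ ∧ ‖remainder A v'‖ < ‖remainder A v‖ ∧
      ∀ u : IntPair m n, u.1 ≠ 0 → ‖u.1‖ < ‖v'.1‖ → ‖remainder A v‖ ≤ ‖remainder A u‖ := by
  classical
  have hex : ∃ R : ℕ, ∃ u : IntPair m n, u.1 ≠ 0 ∧ ‖u.1‖ ≤ R ∧
      ‖remainder A u‖ < ‖remainder A v‖ := by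
    obtain ⟨u, hu, hul⟩ := exists_remainder_lt A hm (hA v hv.1)
    obtain ⟨k, hk⟩ := exists_natCast_eq_norm u.1
    exact ⟨k, u, hu, hk.le, hul⟩
  obtain ⟨u₀, hu₀, hu₀R, hu₀l⟩ := Nat.find_spec hex
  obtain ⟨v', hv', hv'R, hmin⟩ := exists_min_remainder hm A
    ((one_le_norm_of_ne_zero hu₀).trans hu₀R)
  have hl := (hmin u₀ hu₀ hu₀R).trans_lt hu₀l
  refine ⟨v', ⟨hv', fun u hu huv => hmin u hu (huv.trans hv'R)⟩, ?_, hl, fun u hu huv => ?_⟩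
  · by_contra! h
    exact hl.not_ge (hv.2 v' hv' h)
  · by_contra! h
    obtain ⟨k, hk⟩ := exists_natCast_eq_norm u.1
    have h1 : Nat.find hex ≤ k := Nat.find_le ⟨u, hu, hk.le, h⟩
    have h2 : (Nat.find hex : ℝ) ≤ k := by exact_mod_cast h1
    linarith

theorem mulVec_sub_eq_remainder (A : Fin n → Fin m → ℝ) (u : Fin m → ℤ) (v : Fin n → ℤ) :
    (Matrix.of A).mulVec (fun j => (u j : ℝ)) - (fun k => (v k : ℝ)) = remainder A (u, v) := rfl

theorem Xval_eq (x : ℕ → Fin m → ℤ) (i : ℕ) : Xval x i = ‖x i‖ := norm_intCast _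

theorem Lval_eq (A : Fin n → Fin m → ℝ) (x : ℕ → Fin m → ℤ) (y : ℕ → Fin n → ℤ) (i : ℕ) :
    Lval (Matrix.of A) x y i = ‖remainder A (x i, y i)‖ := rfl

theorem totallyIrrational_of_forall {A : Fin n → Fin m → ℝ}
    (hA : ∀ v : IntPair m n, v.1 ≠ 0 → 0 < ‖remainder A v‖) :
    TotallyIrrational (Matrix.of A) := by
  intro u v huv
  rw [mulVec_sub_eq_remainder]
  by_cases h : u = 0
  · exact zero_lt_one.trans_le (one_le_norm_remainder_of_fst_eq_zero A (v := (u, v)) huv h)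
  · exact hA (u, v) h

theorem exists_isBestApproxSeq (hm : 0 < m) {A : Fin n → Fin m → ℝ}
    (hA : ∀ v : IntPair m n, v.1 ≠ 0 → 0 < ‖remainder A v‖) :
    ∃ x y, IsBestApproxSeq (Matrix.of A) x y := by
  obtain ⟨v₀, hv₀, hv₀1, hmin⟩ := exists_min_remainder hm A le_rfl
  have hv₀m : IsMinimalPoint A v₀ := ⟨hv₀, fun u hu h => hmin u hu (h.trans hv₀1)⟩
  choose f hf using fun v : {v // IsMinimalPoint A v} => exists_next_minimalPoint hm hA v.2
  let s : ℕ → {v // IsMinimalPoint A v} := fun i =>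
    Nat.rec ⟨v₀, hv₀m⟩ (fun _ v => ⟨f v, (hf v).1⟩) i
  refine ⟨fun i => (s i).1.1, fun i => (s i).1.2, fun i => (s i).2.1, ?_,
    strictMono_nat_of_lt_succ fun i => ?_, strictAnti_nat_of_succ_lt fun i => (hf (s i)).2.2.1,
    fun i u v hu hui => ?_⟩
  · rw [Xval_eq]
    exact le_antisymm hv₀1 (one_le_norm_of_ne_zero hv₀)
  · rw [Xval_eq, Xval_eq]
    exact (hf (s i)).2.1
  · rw [norm_intCast, Xval_eq] at hui
    exact (hf (s i)).2.2.2 (u, v) hu hui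

variable {A : Fin n → Fin m → ℝ} {x : ℕ → Fin m → ℤ} {y : ℕ → Fin n → ℤ}

theorem IsBestApproxSeq.le_remainder (h : IsBestApproxSeq (Matrix.of A) x y) (i : ℕ)
    (u : IntPair m n) (hu : u.1 ≠ 0) (hui : ‖u.1‖ < ‖x (i + 1)‖) :
    ‖remainder A (x i, y i)‖ ≤ ‖remainder A u‖ :=
  h.best i u.1 u.2 hu (by rwa [norm_intCast, Xval_eq])

theorem IsBestApproxSeq.norm_lt (h : IsBestApproxSeq (Matrix.of A) x y) (i : ℕ) :
    ‖x i‖ < ‖x (i + 1)‖ := by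
  have := h.xStrictMono (Nat.lt_succ_self i)
  rwa [Xval_eq, Xval_eq] at this

theorem IsBestApproxSeq.remainder_lt (h : IsBestApproxSeq (Matrix.of A) x y) (i : ℕ) :
    ‖remainder A (x (i + 1), y (i + 1))‖ < ‖remainder A (x i, y i)‖ :=
  h.lStrictAnti (Nat.lt_succ_self i)

theorem IsBestApproxSeq.remainder_le_half (h : IsBestApproxSeq (Matrix.of A) x y) (i : ℕ) :
    ‖remainder A (x i, y i)‖ ≤ 1 / 2 := by
  obtain ⟨z, hz⟩ := exists_norm_remainder_le_half A (x i)
  exact (h.le_remainder i (x i, z) (h.nonzero i) (h.norm_lt i)).trans hz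

theorem IsBestApproxSeq.propC (h : IsBestApproxSeq (Matrix.of A) x y)
    (hA : ∀ v : IntPair m n, v.1 ≠ 0 → 0 < ‖remainder A v‖) {N : ℕ} (hN : 2 ≤ N)
    (hsafe : ∀ k, Safe N k A) : PropC (Matrix.of A) x y := by
  have hNr : (2 : ℝ) ≤ N := by exact_mod_cast hN
  refine ⟨(N : ℝ) ^ 2, fun i => ?_⟩
  rw [Lval_eq, Lval_eq]
  have hL := hA (x (i + 1), y (i + 1)) (h.nonzero _)
  set L := ‖remainder A (x (i + 1), y (i + 1))‖ with hLdef
  rw [div_le_iff₀ hL]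
  have hX : 1 < ‖x (i + 1)‖ := (one_le_norm_of_ne_zero (h.nonzero i)).trans_lt (h.norm_lt i)
  set X := ‖x (i + 1)‖ with hXdef
  have hX0 : 0 < X := by linarith
  have hLh := h.remainder_le_half (i + 1)
  by_contra! hcon
  obtain ⟨k, hk1, hk2⟩ := exists_nat_pow_near_of_lt_one (x := L / X) (y := (N : ℝ)⁻¹)
    (by positivity) (by rw [div_le_one hX0]; linarith) (by positivity)
    (inv_lt_one_of_one_lt₀ (by linarith))
  rw [lt_div_iff₀ hX0] at hk1
  rw [div_le_iff₀ hX0] at hk2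
  rcases k with _ | k
  · have h1 : (N : ℝ)⁻¹ < L := by
      have : (0 : ℝ) < (N : ℝ)⁻¹ := by positivity
      rw [zero_add, pow_one] at hk1
      nlinarith
    rw [inv_lt_iff_one_lt_mul₀ (by linarith)] at h1
    have h2 := h.remainder_le_half i
    nlinarith
  · obtain ⟨v', hv', hv'X, hv'r⟩ := hsafe k (x (i + 1), y (i + 1)) hX hk2
    have h1 := h.le_remainder i v' hv' hv'X
    have h2 : scale N k = (N : ℝ) ^ 2 * ((N : ℝ)⁻¹) ^ (k + 1 + 1) := by
      have hne : (N : ℝ) ^ 2 ≠ 0 := by positivity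
      rw [scale, add_assoc, pow_add, inv_pow _ (1 + 1), mul_left_comm, mul_inv_cancel₀ hne, mul_one]
    have h3 : scale N k * X ≤ (N : ℝ) ^ 2 * L := by
      rw [h2, mul_assoc]
      gcongr
    exact absurd hv'r (not_lt.2 (by linarith))

theorem IsBestApproxSeq.not_propB (h : IsBestApproxSeq (Matrix.of A) x y)
    (hjump : ∀ K : ℕ, Jump K A) : ¬ PropB x := by
  rintro ⟨M, hM⟩
  obtain ⟨K, hK⟩ := exists_nat_gt M
  obtain ⟨R, l, ⟨v, hv, hvR, hvl⟩, hgap⟩ := hjump K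
  choose a ha using fun i => exists_natCast_eq_norm (x i)
  have hamono : StrictMono a := strictMono_nat_of_lt_succ fun i => by
    have := h.norm_lt i
    rw [ha, ha] at this
    exact_mod_cast this
  have hex : ∃ i, R < ‖x i‖ := by
    obtain ⟨i, hi⟩ := exists_nat_gt R
    refine ⟨i, hi.trans_le ?_⟩
    rw [ha]
    exact_mod_cast hamono.id_le i
  classical
  have hspec := Nat.find_spec hex
  have hmin := fun j => Nat.find_min hex (m := j)
  have hfirst := h.first
  rw [Xval_eq] at hfirst
  rcases hi : Nat.find hex with _ | i
  · rw [hi, hfirst] at hspec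
    have := one_le_norm_of_ne_zero hv
    linarith
  rw [hi] at hspec hmin
  have hiR : ‖x i‖ ≤ R := not_lt.1 (hmin i (Nat.lt_succ_self i))
  have h1 := h.le_remainder i v hv (hvR.trans_lt hspec)
  have h2 := h.remainder_lt i
  have h3 : (K : ℝ) * R ≤ ‖x (i + 1)‖ := by
    by_contra! hcon
    have := hgap (x (i + 1), y (i + 1)) hspec hcon
    linarith
  have h4 := hM i
  have h5 : 0 < ‖x i‖ := zero_lt_one.trans_le (one_le_norm_of_ne_zero (h.nonzero i))
  rw [Xval_eq, Xval_eq, div_le_iff₀ h5] at h4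
  have h6 : (K : ℝ) * ‖x i‖ ≤ K * R := by gcongr
  have h7 : M * ‖x i‖ < K * ‖x i‖ := by gcongr
  linarith

theorem IsBestApproxSeq.pow_mul_pow_le (h : IsBestApproxSeq (Matrix.of A) x y) (hm : 0 < m)
    (hn : 0 < n) (i : ℕ) :
    ‖remainder A (x i, y i)‖ ^ n * ‖x (i + 1)‖ ^ m ≤ 2 ^ n := by
  classical
  obtain ⟨a, ha⟩ := exists_natCast_eq_norm (x (i + 1))
  have hX : 1 < ‖x (i + 1)‖ := (one_le_norm_of_ne_zero (h.nonzero i)).trans_lt (h.norm_lt i)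
  rw [ha] at hX ⊢
  have ha1 : 1 < a := by exact_mod_cast hX
  have hex : ∃ s : ℕ, a ^ m ≤ (s + 1) ^ n :=
    ⟨a ^ m, (Nat.le_succ _).trans (Nat.le_self_pow hn.ne' _)⟩
  have hspec := Nat.find_spec hex
  have hmin := fun j => Nat.find_min hex (m := j)
  rcases hs : Nat.find hex with _ | s
  · rw [hs, zero_add, one_pow] at hspec
    exact absurd (Nat.one_lt_pow hm.ne' ha1) (not_lt.2 hspec)
  rw [hs] at hspec hmin
  obtain ⟨q, hq, hqa, p, hp⟩ := dirichlet_linear_forms A (A := a - 1) (s := s + 1)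
    (Nat.succ_pos s) (by
      rw [Fintype.card_fin, Fintype.card_fin, Nat.sub_add_cancel (by omega)]
      exact not_le.1 (hmin s (Nat.lt_succ_self s)))
  have hs0 : (0 : ℝ) < 1 / ((s + 1 : ℕ) : ℝ) := by positivity
  have h1 : ‖remainder A (x i, y i)‖ < 1 / ((s + 1 : ℕ) : ℝ) := by
    refine (h.le_remainder i (q, p) hq ?_).trans_lt ((pi_norm_lt_iff hs0).2 fun i => hp i)
    rw [ha, pi_norm_lt_iff (by positivity)]
    intro j
    have := hqa j
    rw [Int.norm_eq_abs]
    have h2 : |q j| < a := by omega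
    exact_mod_cast h2
  have h2 : ‖remainder A (x i, y i)‖ * ((s + 1 + 1 : ℕ) : ℝ) ≤ 2 := by
    rw [lt_div_iff₀ (by positivity)] at h1
    push_cast at h1 ⊢
    have : (0 : ℝ) ≤ s := by positivity
    have := norm_nonneg (remainder A (x i, y i))
    nlinarith
  have h3 : (a : ℝ) ^ m ≤ ((s + 1 + 1 : ℕ) : ℝ) ^ n := by exact_mod_cast hspec
  calc _ ≤ ‖remainder A (x i, y i)‖ ^ n * ((s + 1 + 1 : ℕ) : ℝ) ^ n := by gcongr
    _ = (‖remainder A (x i, y i)‖ * ((s + 1 + 1 : ℕ) : ℝ)) ^ n := by rw [mul_pow]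
    _ ≤ 2 ^ n := by gcongr

theorem IsBestApproxSeq.propB_of_propA (h : IsBestApproxSeq (Matrix.of A) x y) (hm : 0 < m)
    (hn : 0 < n) (hA : PropA (Matrix.of A)) : PropB x := by
  obtain ⟨c, hc, hA⟩ := hA
  refine ⟨2 ^ n / c, fun i => ?_⟩
  rw [Xval_eq, Xval_eq]
  have h1 := hA (x i) (y i) (h.nonzero i)
  rw [norm_intCast, mulVec_sub_eq_remainder] at h1
  have h2 := h.pow_mul_pow_le hm hn i
  have h5 : 0 < ‖x i‖ := zero_lt_one.trans_le (one_le_norm_of_ne_zero (h.nonzero i))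
  have h6 : 1 ≤ ‖x (i + 1)‖ / ‖x i‖ := by
    rw [one_le_div h5]
    exact (h.norm_lt i).le
  refine (le_self_pow₀ h6 hm.ne').trans ?_
  rw [div_pow, div_le_div_iff₀ (by positivity) hc]
  calc _ ≤ ‖x (i + 1)‖ ^ m * (‖x i‖ ^ m * ‖remainder A (x i, y i)‖ ^ n) := by gcongr
    _ = (‖remainder A (x i, y i)‖ ^ n * ‖x (i + 1)‖ ^ m) * ‖x i‖ ^ m := by ring
    _ ≤ _ := by gcongr

end BestApproximations

/-- A schedule that performs a free step at each time and each task `j`, of length `T j`, once, so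
rarely that the tasks make up at most a fraction `1 / q` of the number of free steps. -/
theorem exists_schedule (T : ℕ → ℕ) (q : ℕ) :
    ∃ (ℓ : ℕ → ℕ) (g : ℕ → Option ℕ), ℓ 0 = 0 ∧ (∀ i, q * ℓ i ≤ (q + 1) * i) ∧
      (∀ i, ℓ (i + 1) = ℓ i + 1 + (g i).elim 0 T) ∧ ∀ j, ∃ i, g i = some j := by
  let st : ℕ → ℕ × ℕ := fun i => Nat.rec (0, 0)
    (fun i s => if q * (s.1 + T s.2) ≤ i + 1 then (s.1 + T s.2, s.2 + 1) else s) i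
  have hst (i : ℕ) : st (i + 1) = if q * ((st i).1 + T (st i).2) ≤ i + 1 then
      ((st i).1 + T (st i).2, (st i).2 + 1) else st i := rfl
  let g : ℕ → Option ℕ := fun i =>
    if q * ((st i).1 + T (st i).2) ≤ i + 1 then some (st i).2 else none
  refine ⟨fun i => i + (st i).1, g, rfl, fun i => ?_, fun i => ?_, fun j => ?_⟩
  · have h : q * (st i).1 ≤ i := by
      induction i with
      | zero => simp [st]
      | succ i ih =>
        rw [hst]
        split_ifs with h
        · exact h
        · exact ih.trans (Nat.le_succ i)
    nlinarith
  · dsimp only [g]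
    rw [hst]
    split_ifs <;> simp <;> omega
  · have hfire (i j : ℕ) (hj : (st i).2 = j) : ∃ i', g i' = some j ∧ (st (i' + 1)).2 = j + 1 := by
      by_contra! hno
      have hconst (d : ℕ) : st (i + d) = st i := by
        induction d with
        | zero => rfl
        | succ d ih =>
          rw [← Nat.add_assoc, hst]
          by_cases h : q * ((st (i + d)).1 + T (st (i + d)).2) ≤ i + d + 1
          · refine absurd ?_ (hno (i + d) ?_)
            · rw [hst, if_pos h, ih, hj]
            · dsimp only [g]
              rw [if_pos h, ih, hj]
          · rw [if_neg h, ih]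
      have h : q * ((st (i + q * ((st i).1 + T (st i).2))).1 +
          T (st (i + q * ((st i).1 + T (st i).2))).2) ≤ i + q * ((st i).1 + T (st i).2) + 1 := by
        rw [hconst]
        omega
      refine hno (i + q * ((st i).1 + T (st i).2)) ?_ ?_
      · dsimp only [g]
        rw [if_pos h, hconst, hj]
      · rw [hst, if_pos h, hconst, hj]
    have hreach : ∃ i, (st i).2 = j := by
      induction j with
      | zero => exact ⟨0, rfl⟩
      | succ j ih =>
        obtain ⟨i, hi⟩ := ih
        obtain ⟨i', -, h⟩ := hfire i j hi
        exact ⟨i' + 1, h⟩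
    obtain ⟨i, hi⟩ := hreach
    obtain ⟨i', h, -⟩ := hfire i j hi
    exact ⟨i', h⟩

section CantorSet

variable {m n : ℕ}

/-- A Cantor set of matrices, parametrised by sequences of digits, all of whose points are safe at
all levels and satisfy the conditions `Good j`, each of which can be enforced from any ball. -/
theorem exists_cantor_map {N b : ℕ} (hN : 0 < N)
    (hsep : ∀ k (ξ : Fin n → Fin m → ℝ), ∃ ch : Fin b → Fin n → Fin m → ℝ,
      (∀ a, Advances N k ξ (k + 1) (ch a)) ∧
      ∀ a a', a ≠ a' → 3 * scale N (k + 1) ≤ dist (ch a) (ch a'))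
    {Good : ℕ → (Fin n → Fin m → ℝ) → Prop}
    (hgood : ∀ j, ∃ T : ℕ, ∀ k (ξ : Fin n → Fin m → ℝ), ∃ ξ', Advances N k ξ (k + T) ξ' ∧
      ∀ η ∈ Metric.closedBall ξ' (scale N (k + T)), Good j η) (q : ℕ) :
    ∃ (ℓ : ℕ → ℕ) (F : (ℕ → Fin b) → Fin n → Fin m → ℝ), (∀ i, q * ℓ i ≤ (q + 1) * i) ∧
      (∀ d k, Safe N k (F d)) ∧ (∀ d j, Good j (F d)) ∧
      ∀ (d d' : ℕ → Fin b) i, (∀ j < i, d j = d' j) → d i ≠ d' i →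
        scale N (ℓ i + 1) ≤ dist (F d) (F d') := by
  choose T hT using hgood
  obtain ⟨ℓ, g, hℓ0, hℓ, hℓg, hg⟩ := exists_schedule T q
  have hstep (i : ℕ) (ξ : Fin n → Fin m → ℝ) : ∃ c : Fin b → Fin n → Fin m → ℝ,
      (∀ a, Advances N (ℓ i) ξ (ℓ (i + 1)) (c a)) ∧
      (∀ a j, g i = some j → ∀ η ∈ Metric.closedBall (c a) (scale N (ℓ (i + 1))), Good j η) ∧
      ∀ a a', a ≠ a' → ∀ η ∈ Metric.closedBall (c a) (scale N (ℓ (i + 1))),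
        ∀ η' ∈ Metric.closedBall (c a') (scale N (ℓ (i + 1))),
          scale N (ℓ i + 1) ≤ dist η η' := by
    obtain ⟨ch, hch, hchs⟩ := hsep (ℓ i) ξ
    have h (a : Fin b) : ∃ ξ', Advances N (ℓ i + 1) (ch a) (ℓ (i + 1)) ξ' ∧ ∀ j, g i = some j →
        ∀ η ∈ Metric.closedBall ξ' (scale N (ℓ (i + 1))), Good j η := by
      rw [hℓg]
      cases hgi : g i with
      | none => exact ⟨ch a, Advances.refl _ _ _, by simp⟩
      | some j =>
        obtain ⟨ξ', h, h'⟩ := hT j (ℓ i + 1) (ch a)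
        refine ⟨ξ', h, fun j' hj' => ?_⟩
        obtain rfl := Option.some.inj hj'
        exact h'
    choose c hc hcg using h
    refine ⟨c, fun a => (hch a).trans (hc a), hcg, fun a a' haa' η hη η' hη' => ?_⟩
    have h1 := Metric.mem_closedBall.1 ((hc a).2.1 hη)
    have h2 := Metric.mem_closedBall.1 ((hc a').2.1 hη')
    have h3 := hchs a a' haa'
    have h4 := dist_triangle4 (ch a) η η' (ch a')
    rw [dist_comm] at h1
    linarith
  choose c hc hcg hcs using hstep
  let z : (ℕ → Fin b) → ℕ → Fin n → Fin m → ℝ := fun d i =>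
    Nat.rec 0 (fun i ξ => c i ξ (d i)) i
  have hz (d : ℕ → Fin b) (i : ℕ) : z d (i + 1) = c i (z d i) (d i) := rfl
  have hadv (d : ℕ → Fin b) (i : ℕ) : Advances N (ℓ i) (z d i) (ℓ (i + 1)) (z d (i + 1)) :=
    hc i (z d i) (d i)
  have hpoint (d : ℕ → Fin b) : ∃ A, ∀ i, A ∈ Metric.closedBall (z d i) (scale N (ℓ i)) := by
    have := IsCompact.nonempty_iInter_of_sequence_nonempty_isCompact_isClosed
      (fun i => Metric.closedBall (z d i) (scale N (ℓ i))) (fun i => (hadv d i).2.1)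
      (fun i => ⟨_, Metric.mem_closedBall_self (scale_pos hN _).le⟩) (isCompact_closedBall _ _)
      (fun i => Metric.isClosed_closedBall)
    obtain ⟨A, hA⟩ := this
    exact ⟨A, Set.mem_iInter.1 hA⟩
  choose F hF using hpoint
  refine ⟨ℓ, F, hℓ, fun d k => ?_, fun d j => ?_, fun d d' i hdd' hi => ?_⟩
  · have hsafe (i : ℕ) : i ≤ ℓ i ∧ ∀ k < ℓ i, Safe N k (F d) := by
      induction i with
      | zero => exact ⟨Nat.zero_le _, fun k hk => by omega⟩
      | succ i ih =>
        refine ⟨by rw [hℓg]; omega, fun k hk => ?_⟩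
        rcases lt_or_ge k (ℓ i) with h | h
        · exact ih.2 k h
        · exact (hadv d i).2.2 _ (hF d (i + 1)) k h hk
    exact (hsafe (k + 1)).2 k (hsafe (k + 1)).1
  · obtain ⟨i, hi⟩ := hg j
    exact hcg i (z d i) (d i) j hi _ (hF d (i + 1))
  · have hzz (j : ℕ) (hj : j ≤ i) : z d j = z d' j := by
      induction j with
      | zero => rfl
      | succ j ih => rw [hz, hz, ih (by omega), hdd' j (by omega)]
    refine hcs i (z d i) (d i) (d' i) hi _ (hF d (i + 1)) _ ?_
    rw [hzz i le_rfl]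
    exact hF d' (i + 1)

end CantorSet

open scoped NNReal ENNReal in
/-- A set that contains a Cantor-like family of points, separated according to the first digit in
which they differ, has large Hausdorff dimension. -/
theorem le_dimH_of_separated {X : Type*} [MetricSpace X] {s : Set X} {b : ℕ} (hb : 2 ≤ b)
    {F : (ℕ → Fin b) → X} (hF : ∀ d, F d ∈ s) {r C : ℝ≥0} (hr : 0 < r)
    (hsep : ∀ (d d' : ℕ → Fin b) i, (∀ j < i, d j = d' j) → d i ≠ d' i →
      ((b : ℝ) ^ i)⁻¹ ≤ C * dist (F d) (F d') ^ (r : ℝ)) :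
    (r : ℝ≥0∞) ≤ dimH s := by
  have : NeZero b := ⟨by omega⟩
  have hb1 : 1 < b := by omega
  let G : ℝ → X := fun t => F (Real.digits t b)
  set I : Set ℝ := Set.Ico 0 1 with hI
  have hG {t t' : ℝ} (ht : t ∈ I) (ht' : t' ∈ I) :
      dist t t' ≤ C * dist (G t) (G t') ^ (r : ℝ) := by
    by_cases h : Real.digits t b = Real.digits t' b
    · rw [← Real.ofDigits_digits hb1 ht, ← Real.ofDigits_digits hb1 ht', h, dist_self]
      positivity
    · have hex : ∃ i, Real.digits t b i ≠ Real.digits t' b i := Function.ne_iff.1 h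
      classical
      have hlt : ∀ j < Nat.find hex, Real.digits t b j = Real.digits t' b j := fun j hj =>
        not_not.1 (Nat.find_min hex hj)
      refine le_trans ?_ (hsep _ _ (Nat.find hex) hlt (Nat.find_spec hex))
      have := Real.abs_ofDigits_sub_ofDigits_le hlt
      rwa [Real.ofDigits_digits hb1 ht, Real.ofDigits_digits hb1 ht'] at this
  have hinj : Set.InjOn G I := fun t ht t' ht' h => by
    have := hG ht ht'
    rw [h, dist_self, Real.zero_rpow (by exact_mod_cast hr.ne'), mul_zero] at this
    exact dist_le_zero.1 this
  have hleft := hinj.leftInvOn_invFunOn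
  have hHolder : HolderOnWith C r (Function.invFunOn G I) (G '' I) := by
    rintro _ ⟨t, ht, rfl⟩ _ ⟨t', ht', rfl⟩
    rw [hleft ht, hleft ht', edist_dist, edist_dist, ENNReal.ofReal_rpow_of_nonneg dist_nonneg
      r.coe_nonneg, ← ENNReal.ofReal_coe_nnreal, ← ENNReal.ofReal_mul C.coe_nonneg]
    exact ENNReal.ofReal_le_ofReal (hG ht ht')
  have hdim := hHolder.dimH_image_le hr
  rw [hleft.image_image, Real.dimH_of_nonempty_interior (by rw [hI, interior_Ico]; simp),
    Module.finrank_self, Nat.cast_one] at hdim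
  have h1 : (r : ℝ≥0∞) ≤ dimH (G '' I) := by
    have h2 := mul_le_mul_left hdim (r : ℝ≥0∞)
    rwa [one_mul, ENNReal.div_mul_cancel (by exact_mod_cast hr.ne') ENNReal.coe_ne_top] at h2
  refine h1.trans (dimH_mono ?_)
  rintro _ ⟨t, -, rfl⟩
  exact hF _

section Dimension

variable {m n : ℕ}

theorem exists_cantor_parameter {D r : ℝ} (hr : r < D) (B : ℕ) :
    ∃ p : ℕ, B ≤ p ∧ 4 * (6 * (p : ℝ)) ^ r ≤ (p : ℝ) ^ D := by
  have h := ((tendsto_rpow_atTop (sub_pos.2 hr)).comp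
    (tendsto_natCast_atTop_atTop (R := ℝ))).eventually_ge_atTop (4 * (6 : ℝ) ^ r)
  obtain ⟨p, hp, hpB⟩ := (h.and (Filter.eventually_ge_atTop (B + 1))).exists
  have hp0 : (0 : ℝ) < p := by exact_mod_cast (show 0 < p by omega)
  refine ⟨p, by omega, ?_⟩
  have h1 := mul_le_mul_of_nonneg_right hp (Real.rpow_nonneg hp0.le r)
  dsimp only [Function.comp_apply] at h1
  rw [← Real.rpow_add hp0, sub_add_cancel] at h1
  rwa [Real.mul_rpow (by norm_num) hp0.le, ← mul_assoc]

theorem inv_pow_le_mul_scale_rpow {N b q ℓ i : ℕ} (hN : 1 ≤ N) (hq : 0 < q) {r r' : ℝ}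
    (hr : 0 ≤ r) (hrq : r * (q + 1) ≤ r' * q) (hb : (N : ℝ) ^ r' ≤ b)
    (hℓ : q * ℓ ≤ (q + 1) * i) :
    ((b : ℝ) ^ i)⁻¹ ≤ (N : ℝ) ^ r * scale N (ℓ + 1) ^ r := by
  have hN1 : (1 : ℝ) ≤ N := by exact_mod_cast hN
  have hN0 : (0 : ℝ) < N := by linarith
  have hq0 : (0 : ℝ) < q := by exact_mod_cast hq
  have hℓr : (q : ℝ) * ℓ ≤ (q + 1) * i := by exact_mod_cast hℓ
  have h1 : r * ℓ ≤ r' * i := by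
    refine le_of_mul_le_mul_left ?_ hq0
    have h2 := mul_le_mul_of_nonneg_left hℓr hr
    have h3 := mul_le_mul_of_nonneg_right hrq (Nat.cast_nonneg (α := ℝ) i)
    linarith
  have h2 : (N : ℝ) ^ r * scale N (ℓ + 1) ^ r = ((N : ℝ) ^ (r * ℓ))⁻¹ := by
    rw [scale, ← Real.mul_rpow hN0.le (by positivity), pow_succ', ← mul_assoc,
      mul_inv_cancel₀ hN0.ne', one_mul, inv_pow, Real.inv_rpow (by positivity),
      ← Real.rpow_natCast, ← Real.rpow_mul hN0.le, mul_comm r]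
  rw [h2]
  refine inv_anti₀ (by positivity) ((Real.rpow_le_rpow_of_exponent_le hN1 h1).trans ?_)
  rw [Real.rpow_mul hN0.le, Real.rpow_natCast]
  exact pow_le_pow_left₀ (by positivity) hb i

open scoped NNReal ENNReal in
theorem exists_safe_jump_set (hm : 0 < m) (hn : 2 ≤ n) {r : ℝ≥0} (hr0 : 0 < r)
    (hr : (r : ℝ) < (m * n : ℕ)) :
    ∃ s : Set (Fin n → Fin m → ℝ), s.Nonempty ∧ (r : ℝ≥0∞) ≤ dimH s ∧ ∀ A ∈ s,
      (∃ N ≥ 2, ∀ k, Safe N k A) ∧ (∀ K : ℕ, Jump K A) ∧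
        ∀ v : IntPair m n, v.1 ≠ 0 → 0 < ‖remainder A v‖ := by
  have hmn : 0 < m * n := Nat.mul_pos hm (by omega)
  obtain ⟨c, hc1, hc⟩ := exists_transversal m n
  obtain ⟨r', hrr', hr'⟩ := exists_between hr
  obtain ⟨q, hq⟩ := exists_nat_gt ((r : ℝ) / (r' - r))
  have hq0 : 0 < q := by
    have : (0 : ℝ) < q := lt_of_le_of_lt (div_nonneg r.coe_nonneg (sub_pos.2 hrr').le) hq
    exact_mod_cast this
  have hrq : (r : ℝ) * (q + 1) ≤ r' * q := by
    rw [div_lt_iff₀ (sub_pos.2 hrr')] at hq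
    linarith
  obtain ⟨B, hB⟩ := exists_nat_ge (2 * m * c * (3 * stepBound m n + 1))
  obtain ⟨p, hpB, hp⟩ := exists_cantor_parameter hr'
    (B + 2 * stepBound m n + 2 * (packingBound m n * (m + 2)) + 4)
  set N := 6 * p with hN
  have hN0 : 0 < N := by omega
  set b := p ^ (m * n) / 2 with hb
  have hpp : p ≤ p ^ (m * n) := Nat.le_self_pow hmn.ne' p
  have hb4 : p ^ (m * n) ≤ 4 * b := by omega
  have hb2 : 2 ≤ b := by omega
  have hNb : (N : ℝ) ^ r' ≤ b := by
    have h1 : ((p : ℝ) ^ (m * n)) ≤ 4 * b := by exact_mod_cast hb4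
    rw [Real.rpow_natCast] at hp
    have h2 : (N : ℝ) = 6 * p := by rw [hN]; push_cast; rfl
    rw [h2]
    linarith
  have hNc : 2 * m * c * (3 * stepBound m n + 1) ≤ (N : ℝ) :=
    hB.trans (by exact_mod_cast (show B ≤ N by omega))
  obtain ⟨x₀, hx₀, -⟩ := exists_norm_eq_one hm
  have : Nonempty {v : IntPair m n // v.1 ≠ 0} := ⟨⟨(x₀, 0), hx₀⟩⟩
  obtain ⟨w, hw⟩ := exists_surjective_nat {v : IntPair m n // v.1 ≠ 0}
  obtain ⟨ℓ, F, hℓ, hsafe, hgood, hsep⟩ := exists_cantor_map (b := b) hN0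
    (exists_separated_advances hm (by omega : 0 < n) (by omega) (by omega))
    (fun j => exists_advances_jump hm hn (by omega) hc1 hc hNc (Nat.cast_nonneg j) (w j).2) q
  refine ⟨Set.range F, ⟨F fun _ => ⟨0, by omega⟩, Set.mem_range_self _⟩, ?_, ?_⟩
  · refine le_dimH_of_separated hb2 Set.mem_range_self hr0 (C := (N : ℝ≥0) ^ (r : ℝ))
      fun d d' i hdd' hi => ?_
    rw [NNReal.coe_rpow, NNReal.coe_natCast]
    refine (inv_pow_le_mul_scale_rpow (by omega) hq0 r.coe_nonneg hrq hNb (hℓ i)).trans ?_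
    gcongr
    · exact (scale_pos hN0 _).le
    · exact hsep d d' i hdd' hi
  · rintro _ ⟨d, rfl⟩
    refine ⟨⟨N, by omega, hsafe d⟩, fun K => (hgood d K).1, fun v hv => ?_⟩
    obtain ⟨j, hj⟩ := hw ⟨v, hv⟩
    have := (hgood d j).2
    rwa [hj] at this

end Dimension

/-- For `m ≥ 1, n ≥ 2`, the set of totally irrational `ξ ∈ ℝ^{n×m}`
satisfying (C) but neither (A) nor (B) is nonempty of full Hausdorff dimension `mn`. -/
theorem stmt_5 (m n : ℕ) (hm : 1 ≤ m) (hn : 2 ≤ n) :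
    ({A : Fin n → Fin m → ℝ | TotallyIrrational (Matrix.of A) ∧
        (∃ (x : ℕ → Fin m → ℤ) (y : ℕ → Fin n → ℤ),
          IsBestApproxSeq (Matrix.of A) x y ∧ PropC (Matrix.of A) x y ∧ ¬ PropB x) ∧
        ¬ PropA (Matrix.of A)} : Set (Fin n → Fin m → ℝ)).Nonempty ∧
    dimH ({A : Fin n → Fin m → ℝ | TotallyIrrational (Matrix.of A) ∧
        (∃ (x : ℕ → Fin m → ℤ) (y : ℕ → Fin n → ℤ),
          IsBestApproxSeq (Matrix.of A) x y ∧ PropC (Matrix.of A) x y ∧ ¬ PropB x) ∧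
        ¬ PropA (Matrix.of A)} : Set (Fin n → Fin m → ℝ)) = ((m * n : ℕ) : ENNReal) := by
  set S := {A : Fin n → Fin m → ℝ | TotallyIrrational (Matrix.of A) ∧
        (∃ (x : ℕ → Fin m → ℤ) (y : ℕ → Fin n → ℤ),
          IsBestApproxSeq (Matrix.of A) x y ∧ PropC (Matrix.of A) x y ∧ ¬ PropB x) ∧
        ¬ PropA (Matrix.of A)} with hS
  have hmem (A : Fin n → Fin m → ℝ) (hA : (∃ N ≥ 2, ∀ k, Safe N k A) ∧ (∀ K : ℕ, Jump K A) ∧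
      ∀ v : IntPair m n, v.1 ≠ 0 → 0 < ‖remainder A v‖) : A ∈ S := by
    obtain ⟨⟨N, hN, hsafe⟩, hjump, hirr⟩ := hA
    obtain ⟨x, y, h⟩ := exists_isBestApproxSeq hm hirr
    have hB := h.not_propB hjump
    exact ⟨totallyIrrational_of_forall hirr, ⟨x, y, h, h.propC hirr hN hsafe, hB⟩,
      fun hA => hB (h.propB_of_propA hm (by omega) hA)⟩
  have hmn : (0 : ℝ) < (m * n : ℕ) := by
    exact_mod_cast Nat.mul_pos hm (by omega)
  refine ⟨?_, le_antisymm ?_ ?_⟩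
  · obtain ⟨r, hr0, hr⟩ := exists_between hmn
    obtain ⟨s, ⟨A, hA⟩, -, hs⟩ := exists_safe_jump_set hm hn (r := ⟨r, hr0.le⟩) hr0 hr
    exact ⟨A, hmem A (hs A hA)⟩
  · refine (dimH_mono (Set.subset_univ S)).trans ?_
    rw [Real.dimH_univ_eq_finrank]
    simp [Module.finrank_pi_fintype, mul_comm]
  · refine ENNReal.le_of_forall_nnreal_lt fun r hr => ?_
    rcases eq_or_ne r 0 with rfl | hr0
    · simp
    · obtain ⟨s, -, hdim, hs⟩ := exists_safe_jump_set hm hn (pos_iff_ne_zero.2 hr0)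
        (by exact_mod_cast hr)
      exact hdim.trans (dimH_mono fun A hA => hmem A (hs A hA))
end

section
/- Let m = 2 and n = 1, and let ξ ∈ ℝ^{1×2} be totally irrational with best approximation sequences (X_i), (L_i). If sup_{i≥1} X_{i+1}/X_i < ∞ (Property (B)), then ξ is not singular, i.e. X_{i+1}^2 · L_i^1 does not tend to 0 as i → ∞. -/
open Filter

/-- A bound for a `2 × 2` determinant from bounds on its columns. -/
theorem abs_minor_le {a a' r r' X' L : ℝ} {X : ℝ} (ha : |a| ≤ X) (ha' : |a'| ≤ X')
    (hXX : X ≤ X') (hr : |r| ≤ L) (hr' : |r'| ≤ L) : |a * r' - a' * r| ≤ 2 * (X' * L) := by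
  have hX' : 0 ≤ X' := (abs_nonneg _).trans ha'
  have h₁ : |a * r'| ≤ X' * L := by
    rw [abs_mul]
    exact mul_le_mul (ha.trans hXX) hr' (abs_nonneg _) hX'
  have h₂ : |a' * r| ≤ X' * L := by
    rw [abs_mul]
    exact mul_le_mul ha' hr (abs_nonneg _) hX'
  linarith [abs_sub (a * r') (a' * r)]

theorem Int.eq_zero_of_abs_cast_lt_one {k : ℤ} (h : |(k : ℝ)| < 1) : k = 0 :=
  Int.abs_lt_one_iff.mp (by exact_mod_cast h)

/-- A sequence of integer triples `(a, b, c)` with strictly increasing heights `X` and strictly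
decreasing remainders `L = |α a + β b - c|` cannot satisfy `X (i + 1) ^ 2 * L i → 0` with
`X (i + 1) / X i` bounded, unless `β` is rational. -/
theorem exists_int_mul_eq_of_tendsto {α β : ℝ} {a b c : ℕ → ℤ} {X L : ℕ → ℝ} {M : ℝ}
    (ha : ∀ i, |(a i : ℝ)| ≤ X i) (hb : ∀ i, |(b i : ℝ)| ≤ X i)
    (hX : ∀ i, X i = |(a i : ℝ)| ∨ X i = |(b i : ℝ)|)
    (hL : ∀ i, L i = |α * a i + β * b i - c i|) (hLpos : ∀ i, 0 < L i)
    (hXmono : StrictMono X) (hLanti : StrictAnti L) (hXone : ∀ i, 1 ≤ X i)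
    (hM : ∀ i, X (i + 1) ≤ M * X i)
    (hlim : Tendsto (fun i => X (i + 1) ^ 2 * L i) atTop (nhds 0)) :
    ∃ p q : ℤ, p ≠ 0 ∧ β * p = q := by
  have hsmall : Tendsto (fun i => X (i + 1) * L i) atTop (nhds 0) := by
    refine squeeze_zero (fun i => ?_) (fun i => ?_) hlim
    · exact mul_nonneg (zero_le_one.trans (hXone _)) (hLpos i).le
    · refine mul_le_mul_of_nonneg_right ?_ (hLpos i).le
      nlinarith [hXone (i + 1)]
  let r : ℕ → ℝ := fun i => α * a i + β * b i - c i
  have hr : ∀ i, |r i| = L i := fun i => (hL i).symm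
  have hr' : ∀ i, |r (i + 1)| ≤ L i := fun i => (hr _).trans_le (hLanti i.lt_succ_self).le
  have hXle : ∀ i, X i ≤ X (i + 1) := fun i => (hXmono i.lt_succ_self).le
  let p : ℕ → ℤ := fun i => a i * b (i + 1) - a (i + 1) * b i
  let q : ℕ → ℤ := fun i => a i * c (i + 1) - a (i + 1) * c i
  let s : ℕ → ℤ := fun i => b i * c (i + 1) - b (i + 1) * c i
  let D : ℕ → ℤ := fun i => a (i + 2) * s i - b (i + 2) * q i + c (i + 2) * p i
  have hq : ∀ i, β * p i - q i = a i * r (i + 1) - a (i + 1) * r i := fun i => by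
    simp only [p, q, r]; push_cast; ring
  have hs : ∀ i, -α * p i - s i = b i * r (i + 1) - b (i + 1) * r i := fun i => by
    simp only [p, s, r]; push_cast; ring
  have hqle : ∀ i, |β * p i - q i| ≤ 2 * (X (i + 1) * L i) := fun i =>
    hq i ▸ abs_minor_le (ha i) (ha _) (hXle i) (hr i).le (hr' i)
  have hsle : ∀ i, |-α * p i - s i| ≤ 2 * (X (i + 1) * L i) := fun i =>
    hs i ▸ abs_minor_le (hb i) (hb _) (hXle i) (hr i).le (hr' i)
  -- Consecutive vectors are independent, and the minor `p` detects this eventually.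
  have hp : ∀ᶠ i in atTop, p i ≠ 0 := by
    filter_upwards [hsmall.eventually_lt_const (show (0 : ℝ) < 1 / 2 by norm_num)] with i hi h0
    have hq0 : q i = 0 := Int.eq_zero_of_abs_cast_lt_one (by
      have := hqle i
      simp only [h0, Int.cast_zero, mul_zero, zero_sub, abs_neg] at this
      linarith)
    have hs0 : s i = 0 := Int.eq_zero_of_abs_cast_lt_one (by
      have := hsle i
      simp only [h0, Int.cast_zero, mul_zero, zero_sub, abs_neg] at this
      linarith)
    have hlt : X i * L (i + 1) < X (i + 1) * L i :=
      mul_lt_mul (hXmono i.lt_succ_self) (hLanti i.lt_succ_self).le (hLpos _)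
        (zero_le_one.trans (hXone _))
    have key : ∀ e e' : ℝ, |e| ≤ X i → X (i + 1) = |e'| → e * r (i + 1) - e' * r i ≠ 0 := by
      intro e e' he he' h
      have h' := congrArg abs (sub_eq_zero.mp h)
      rw [abs_mul, abs_mul, hr, hr, ← he'] at h'
      linarith [mul_le_mul_of_nonneg_right he (hLpos (i + 1)).le]
    rcases hX (i + 1) with h | h
    · exact key _ _ (ha i) h (by rw [← hq, h0, hq0]; simp)
    · exact key _ _ (hb i) h (by rw [← hs, h0, hs0]; simp)
  -- Three consecutive vectors are eventually dependent.
  have hD : ∀ᶠ i in atTop, D i = 0 := by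
    have hlim' := (hlim.const_mul (6 * M)).eventually_lt_const
      (show 6 * M * 0 < 1 by norm_num)
    filter_upwards [hlim'] with i hi
    apply Int.eq_zero_of_abs_cast_lt_one
    have hexp : (D i : ℝ) = b (i + 2) * (a i * r (i + 1) - a (i + 1) * r i)
        - a (i + 2) * (b i * r (i + 1) - b (i + 1) * r i)
        - r (i + 2) * p i := by
      simp only [D, p, q, s, r]; push_cast; ring
    have h₁ := hq i ▸ hqle i
    have h₂ := hs i ▸ hsle i
    have hX0 : ∀ j, 0 ≤ X j := fun j => zero_le_one.trans (hXone j)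
    have hp' : |(p i : ℝ)| ≤ 2 * (X (i + 1) * X (i + 2)) := by
      have := abs_minor_le (ha i) (ha (i + 1)) (hXle i) ((hb i).trans ((hXle i).trans (hXle _)))
        ((hb (i + 1)).trans (hXle _))
      simpa only [p, Int.cast_sub, Int.cast_mul] using this
    have hr₂ : |r (i + 2)| ≤ L i :=
      (hr _).trans_le (hLanti (show i < i + 2 by omega)).le
    have e₁ := mul_le_mul (hb (i + 2)) h₁ (abs_nonneg _) (hX0 _)
    have e₂ := mul_le_mul (ha (i + 2)) h₂ (abs_nonneg _) (hX0 _)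
    have e₃ := mul_le_mul hr₂ hp' (abs_nonneg _) (hLpos i).le
    rw [← abs_mul] at e₁ e₂ e₃
    have e₄ := mul_le_mul_of_nonneg_right (hM (i + 1)) (mul_nonneg (hX0 (i + 1)) (hLpos i).le)
    rw [hexp]
    refine (abs_sub _ _).trans_lt ?_
    refine (add_le_add_left (abs_sub _ _) _).trans_lt ?_
    simp only [add_assoc, Nat.reduceAdd] at e₄
    nlinarith
  obtain ⟨N, hN⟩ := eventually_atTop.mp (hp.and hD)
  have hpar : ∀ i, N ≤ i → q i * p N = q N * p i := by
    intro i hi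
    induction i, hi using Nat.le_induction with
    | base => rfl
    | succ i hi ih =>
      have hstep : q i * p (i + 1) - q (i + 1) * p i = -D i * a (i + 1) := by
        simp only [D, p, q, s]; ring
      rw [(hN i hi).2, neg_zero, zero_mul, sub_eq_zero] at hstep
      apply mul_left_cancel₀ (hN i hi).1
      linear_combination (-p N) * hstep + p (i + 1) * ih
  refine ⟨p N, q N, (hN N le_rfl).1, ?_⟩
  have hbound : ∀ᶠ i in atTop,
      |β * p N - q N| ≤ |(p N : ℝ)| * (2 * (X (i + 1) * L i)) := by
    filter_upwards [eventually_ge_atTop N] with i hi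
    have hone : (1 : ℝ) ≤ |(p i : ℝ)| := by
      exact_mod_cast Int.one_le_abs (hN i hi).1
    have hpar' : (q i : ℝ) * p N = q N * p i := by exact_mod_cast hpar i hi
    calc |β * p N - q N| ≤ |(p i : ℝ)| * |β * p N - q N| :=
          le_mul_of_one_le_left (abs_nonneg _) hone
      _ = |(p N : ℝ)| * |β * p i - q i| := by
          rw [← abs_mul, ← abs_mul]
          congr 1
          linear_combination hpar'
      _ ≤ _ := mul_le_mul_of_nonneg_left (hqle i) (abs_nonneg _)
  have hzero := ge_of_tendsto ((hsmall.const_mul 2).const_mul |(p N : ℝ)|) hbound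
  rw [mul_zero, mul_zero] at hzero
  exact sub_eq_zero.mp (abs_nonpos_iff.mp hzero)

theorem norm_fin_one (f : Fin 1 → ℝ) : ‖f‖ = |f 0| := by
  rw [Pi.norm_def]; simp

theorem norm_fin_two (f : Fin 2 → ℝ) : ‖f‖ = max |f 0| |f 1| := by
  rw [Pi.norm_def]; simp [Fin.univ_succ]

/-- For `m = 2, n = 1`: if (B) holds then `ξ` is not singular,
i.e. `X_{i+1}² · L_i¹` does not tend to `0`. -/
theorem stmt_8 (ξ : Matrix (Fin 1) (Fin 2) ℝ) (hirr : TotallyIrrational ξ)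
    (x : ℕ → Fin 2 → ℤ) (y : ℕ → Fin 1 → ℤ) (hxy : IsBestApproxSeq ξ x y)
    (hB : PropB x) :
    ¬ Tendsto (fun i => Xval x (i + 1) ^ 2 * Lval ξ x y i ^ 1) atTop (nhds 0) := by
  intro hlim
  obtain ⟨M, hM⟩ := hB
  have hXone : ∀ i, 1 ≤ Xval x i := fun i =>
    hxy.first.symm.trans_le (hxy.xStrictMono.monotone (Nat.zero_le i))
  have hX : ∀ i, Xval x i = max |(x i 0 : ℝ)| |(x i 1 : ℝ)| := fun i => norm_fin_two _
  obtain ⟨p, q, hp, hpq⟩ := exists_int_mul_eq_of_tendsto (α := ξ 0 0) (β := ξ 0 1)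
    (a := fun i => x i 0) (b := fun i => x i 1) (c := fun i => y i 0)
    (X := Xval x) (L := Lval ξ x y) (M := M)
    (fun i => hX i ▸ le_max_left _ _) (fun i => hX i ▸ le_max_right _ _)
    (fun i => hX i ▸ max_choice _ _)
    (fun i => by
      rw [Lval, norm_fin_one]
      simp [Matrix.mulVec, dotProduct, Fin.sum_univ_two])
    (fun i => hirr _ _ fun h => hxy.nonzero i (congrArg Prod.fst h))
    hxy.xStrictMono hxy.lStrictAnti hXone
    (fun i => (div_le_iff₀ (zero_lt_one.trans_le (hXone i))).mp (hM i))
    (by simpa only [pow_one] using hlim)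
  have h := hirr ![0, p] ![q] fun h => hp (by
    simpa using congrFun (congrArg Prod.fst h) 1)
  rw [norm_fin_one] at h
  simp [Matrix.mulVec, dotProduct, Fin.sum_univ_two, hpq] at h
end
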